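/- Let K = Q(√−5). Then the group X₀(11)(K) has exactly 5 elements, the group X₀(17)(K) has exactly 4 elements, and the group X₀(19)(K) has exactly 3 elements; in each case X₀(p)(K) coincides with the group X₀(p)(Q) of rational points. -/

import Mathlib

open Polynomial IntermediateField NumberField

/-- The modular curve `X₀(11)`: the elliptic curve `y² + y = x³ - x² - 10x - 20`
(Cremona label 11a1), with coefficients in the field `K`. -/
noncomputable def X0_11 (K : Type*) [Field K] : WeierstrassCurve.Affine K :=
  { a₁ := 0, a₂ := -1, a₃ := 1, a₄ := -10, a₆ := -20 }

/-- The modular curve `X₀(17)`: the elliptic curve `y² + xy + y = x³ - x² - x - 14`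
(Cremona label 17a1), with coefficients in the field `K`. -/
noncomputable def X0_17 (K : Type*) [Field K] : WeierstrassCurve.Affine K :=
  { a₁ := 1, a₂ := -1, a₃ := 1, a₄ := -1, a₆ := -14 }

/-- The modular curve `X₀(19)`: the elliptic curve `y² + y = x³ + x² - 9x - 15`
(Cremona label 19a3), with coefficients in the field `K`. -/
noncomputable def X0_19 (K : Type*) [Field K] : WeierstrassCurve.Affine K :=
  { a₁ := 0, a₂ := 1, a₃ := 1, a₄ := -9, a₆ := -15 }

/-- Every `K`-point of the Weierstrass curve `W` has both coordinates in the image of `ℚ`,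
i.e. `W(K)` coincides with the group of rational points `W(ℚ)`. -/
def PointsRational {K : Type*} [Field K] [CharZero K] (W : WeierstrassCurve.Affine K) : Prop :=
  ∀ x y : K, W.Nonsingular x y → (∃ a : ℚ, (a : K) = x) ∧ ∃ b : ℚ, (b : K) = y

section

namespace Cub
open Module NumberField

section gen
variable {L : Type*} [Field L] [NumberField L] {p q r : ℚ} {w : L} (b : Basis (Fin 3) ℚ L)

/-- The element with coordinates `(x, y, z)` in the power basis. -/
noncomputable def el (w : L) (x y z : ℚ) : L := (x : L) + y * w + z * w ^ 2

theorem repr_el (h0 : b 0 = 1) (h1 : b 1 = w) (h2 : b 2 = w ^ 2) (x y z : ℚ) (i : Fin 3) :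
    b.repr (el w x y z) i = ![x, y, z] i := by
  have : el w x y z = x • b 0 + y • b 1 + z • b 2 := by
    simp [el, h0, h1, h2, Rat.smul_def]
  rw [this]
  fin_cases i <;> simp

theorem el_surj (h0 : b 0 = 1) (h1 : b 1 = w) (h2 : b 2 = w ^ 2) (u : L) :
    ∃ x y z : ℚ, u = el w x y z := by
  refine ⟨b.repr u 0, b.repr u 1, b.repr u 2, ?_⟩
  conv_lhs => rw [← b.sum_repr u]
  simp [Fin.sum_univ_three, el, h0, h1, h2, Rat.smul_def]

theorem el_inj (h0 : b 0 = 1) (h1 : b 1 = w) (h2 : b 2 = w ^ 2) {x y z x' y' z' : ℚ}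
    (h : el w x y z = el w x' y' z') : x = x' ∧ y = y' ∧ z = z' := by
  have := fun i => congrArg (fun u => b.repr u i) h
  simp only [repr_el b h0 h1 h2] at this
  exact ⟨this 0, this 1, this 2⟩

theorem el_mul (hw : w ^ 3 = p * w ^ 2 + q * w + r) (x y z x' y' z' : ℚ) :
    el w x y z * el w x' y' z' =
      el w (x * x' + r * (y * z' + z * y') + p * r * (z * z'))
        (x * y' + y * x' + q * (y * z' + z * y') + (r + p * q) * (z * z'))
        (x * z' + y * y' + z * x' + p * (y * z' + z * y') + (q + p ^ 2) * (z * z')) := by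
  simp only [el]
  push_cast
  linear_combination ((y * z' + z * y') + (z * z') * (w + p)) * hw

theorem matrix_el (h0 : b 0 = 1) (h1 : b 1 = w) (h2 : b 2 = w ^ 2)
    (hw : w ^ 3 = p * w ^ 2 + q * w + r) (x y z : ℚ) :
    Algebra.leftMulMatrix b (el w x y z) =
      !![x, z * r, (y + z * p) * r;
         y, x + z * q, z * r + (y + z * p) * q;
         z, y + z * p, x + z * q + (y + z * p) * p] := by
  have e0 : b 0 = el w 1 0 0 := by simp [el, h0]
  have e1 : b 1 = el w 0 1 0 := by simp [el, h1]
  have e2 : b 2 = el w 0 0 1 := by simp [el, h2]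
  ext i j
  rw [Algebra.leftMulMatrix_eq_repr_mul]
  fin_cases j
  · simp only [Fin.zero_eta, Fin.isValue, e0, el_mul hw, repr_el b h0 h1 h2]
    fin_cases i <;> simp
  · simp only [Fin.mk_one, Fin.isValue, e1, el_mul hw, repr_el b h0 h1 h2]
    fin_cases i <;> simp <;> ring
  · simp only [Fin.reduceFinMk, Fin.isValue, e2, el_mul hw, repr_el b h0 h1 h2]
    fin_cases i <;> simp <;> ring

theorem trace_el (h0 : b 0 = 1) (h1 : b 1 = w) (h2 : b 2 = w ^ 2)
    (hw : w ^ 3 = p * w ^ 2 + q * w + r) (x y z : ℚ) :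
    Algebra.trace ℚ L (el w x y z) = 3 * x + p * y + (p ^ 2 + 2 * q) * z := by
  rw [Algebra.trace_eq_matrix_trace b, matrix_el b h0 h1 h2 hw, Matrix.trace_fin_three]
  simp
  ring

theorem norm_el (h0 : b 0 = 1) (h1 : b 1 = w) (h2 : b 2 = w ^ 2)
    (hw : w ^ 3 = p * w ^ 2 + q * w + r) (x y z : ℚ) :
    Algebra.norm ℚ (el w x y z) =
      (x * ((x + z * q) * (x + z * q + (y + z * p) * p) - (z * r + (y + z * p) * q) * (y + z * p))
      - z * r * (y * (x + z * q + (y + z * p) * p) - (z * r + (y + z * p) * q) * z)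
      + (y + z * p) * r * (y * (y + z * p) - (x + z * q) * z)) := by
  rw [Algebra.norm_eq_matrix_det b, matrix_el b h0 h1 h2 hw, Matrix.det_fin_three]
  simp
  ring
end gen

section units
variable {L : Type*} [Field L] [NumberField L]

/-- In a cubic field of unit rank one, a unit that is not `±` a square generates the units
modulo squares and signs. -/
theorem units_mod_sq (hf : finrank ℚ L = 3) (hd : discr L < 0) (e : (𝓞 L)ˣ)
    (he : ∀ v : (𝓞 L)ˣ, e ≠ v ^ 2) (he' : ∀ v : (𝓞 L)ˣ, e ≠ - v ^ 2) (u : (𝓞 L)ˣ) :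
    ∃ v : (𝓞 L)ˣ, u = v ^ 2 ∨ u = - v ^ 2 ∨ u = e * v ^ 2 ∨ u = - (e * v ^ 2) := by
  have hc : InfinitePlace.nrRealPlaces L + 2 * InfinitePlace.nrComplexPlaces L = 3 := by
    rw [InfinitePlace.card_add_two_mul_card_eq_rank, hf]
  have hs := sign_discr L
  rw [Int.sign_eq_neg_one_of_neg hd] at hs
  have hr2 : InfinitePlace.nrComplexPlaces L = 1 := by
    have : InfinitePlace.nrComplexPlaces L ≠ 0 := by
      intro h
      rw [h] at hs
      norm_num at hs
    omega
  have hrank : Units.rank L = 1 := by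
    classical
    unfold Units.rank
    rw [InfinitePlace.card_eq_nrRealPlaces_add_nrComplexPlaces]
    omega
  have key : ∃ g : (𝓞 L)ˣ, ∀ x : (𝓞 L)ˣ, ∃ k : ℤ, x = g ^ k ∨ x = - g ^ k := by
    refine ⟨Units.fundSystem L ⟨0, by omega⟩, fun x => ?_⟩
    obtain ⟨⟨ζ, k⟩, hx, -⟩ := Units.exist_unique_eq_mul_prod L x
    refine ⟨k ⟨0, by omega⟩, ?_⟩
    have hp : ∏ i, (Units.fundSystem L i) ^ (k i) =
        Units.fundSystem L ⟨0, by omega⟩ ^ (k ⟨0, by omega⟩) := by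
      apply Fintype.prod_eq_single
      intro i hi
      exact absurd (Fin.ext (by have := i.2; omega)) hi
    simp only at hx
    rw [hp] at hx
    rcases Units.torsion_eq_one_or_neg_one_of_odd_finrank (by rw [hf]; decide) ζ with h | h
    · left; rw [hx, h, one_mul]
    · right; rw [hx, h, neg_one_mul]
  obtain ⟨g, hg⟩ := key
  have par : ∀ k : ℤ, (∃ v : (𝓞 L)ˣ, g ^ k = v ^ 2) ∨ ∃ v : (𝓞 L)ˣ, g ^ k = g * v ^ 2 := by
    intro k
    rcases Int.even_or_odd' k with ⟨m, h | h⟩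
    · left; refine ⟨g ^ m, ?_⟩; rw [h, ← zpow_natCast, ← zpow_mul]; congr 1; push_cast; ring
    · right; refine ⟨g ^ m, ?_⟩
      rw [h, ← zpow_natCast, ← zpow_mul, add_comm, zpow_add, zpow_one]; congr 2; push_cast; ring
  have hge : ∃ v : (𝓞 L)ˣ, g = e * v ^ 2 ∨ g = - (e * v ^ 2) := by
    obtain ⟨k, hk⟩ := hg e
    rcases par k with ⟨v, hv⟩ | ⟨v, hv⟩
    · rcases hk with hk | hk
      · exact absurd (hk.trans hv) (he v)
      · exact absurd (hk.trans (by rw [hv])) (he' v)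
    · refine ⟨v⁻¹, ?_⟩
      rcases hk with hk | hk
      · left; rw [hk, hv, mul_assoc, ← mul_pow]; simp
      · right; rw [hk, hv, neg_mul, neg_neg, mul_assoc, ← mul_pow]; simp
  obtain ⟨s, hs⟩ := hge
  obtain ⟨k, hk⟩ := hg u
  rcases par k with ⟨v, hv⟩ | ⟨v, hv⟩
  · refine ⟨v, ?_⟩
    rcases hk with hk | hk
    · left; rw [hk, hv]
    · right; left; rw [hk, hv]
  · refine ⟨s * v, ?_⟩
    rcases hk with hk | hk <;> rcases hs with hs | hs
    · right; right; left; rw [hk, hv, hs, mul_pow, mul_assoc]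
    · right; right; right; rw [hk, hv, hs, mul_pow, neg_mul, mul_assoc]
    · right; right; right; rw [hk, hv, hs, mul_pow, mul_assoc]
    · right; right; left; rw [hk, hv, hs, mul_pow, neg_mul, neg_neg, mul_assoc]

/-- The gcd argument: an element of square norm `m²` dividing `m²`, such that every integer of
the field is congruent to a rational integer modulo any common divisor of it and `m`, is a unit
times a square. -/
theorem unit_mul_sq [IsPrincipalIdealRing (𝓞 L)] (β : 𝓞 L) (m : ℕ) (hm : m ≠ 0)
    (hN : (Algebra.norm ℤ β).natAbs = m ^ 2) (hdvd : β ∣ (m : 𝓞 L) ^ 2)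
    (hZ : ∀ δ : 𝓞 L, δ ∣ β → δ ∣ (m : 𝓞 L) → ∀ x : 𝓞 L, ∃ n : ℤ, δ ∣ x - n) :
    ∃ (u : (𝓞 L)ˣ) (δ : 𝓞 L), β = u * δ ^ 2 := by
  classical
  obtain ⟨δ, hδ⟩ := (IsPrincipalIdealRing.principal (Ideal.span ({β, (m : 𝓞 L)} : Set (𝓞 L)))).principal
  have hδ' : Ideal.span ({β, (m : 𝓞 L)} : Set (𝓞 L)) = Ideal.span {δ} := hδ
  have d1 : δ ∣ β := by
    rw [← Ideal.mem_span_singleton, ← hδ']; exact Ideal.subset_span (by simp)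
  have d2 : δ ∣ (m : 𝓞 L) := by
    rw [← Ideal.mem_span_singleton, ← hδ']; exact Ideal.subset_span (by simp)
  have hmem : δ ∈ Ideal.span ({β, (m : 𝓞 L)} : Set (𝓞 L)) := by
    rw [hδ']; exact Ideal.mem_span_singleton_self δ
  obtain ⟨s, t, hst⟩ := Ideal.mem_span_pair.mp hmem
  have hdiv : β ∣ δ ^ 2 := by
    have : δ ^ 2 = β * (s ^ 2 * β + 2 * s * t * m) + t ^ 2 * (m : 𝓞 L) ^ 2 := by
      rw [← hst]; ring
    rw [this]
    exact dvd_add (dvd_mul_right _ _) (hdvd.mul_left _)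
  -- norm of δ at most m
  have hcard : (Algebra.norm ℤ δ).natAbs ≤ m := by
    rw [← Ideal.absNorm_span_singleton, Ideal.absNorm_apply, Submodule.cardQuot_apply]
    have : NeZero m := ⟨hm⟩
    let I : Ideal (𝓞 L) := Ideal.span {δ}
    have hsurj : Function.Surjective (fun i : Fin m => (Ideal.Quotient.mk I) ((i : ℕ) : 𝓞 L)) := by
      intro y
      obtain ⟨x, rfl⟩ := Ideal.Quotient.mk_surjective y
      obtain ⟨n, hn⟩ := hZ δ d1 d2 x
      have hmpos : (0 : ℤ) < m := by exact_mod_cast Nat.pos_of_ne_zero hm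
      have h1 := Int.emod_nonneg n hmpos.ne'
      have h2 := Int.emod_lt_of_pos n hmpos
      refine ⟨⟨(n % m).toNat, by omega⟩, ?_⟩
      apply Eq.symm
      rw [Ideal.Quotient.eq, Ideal.mem_span_singleton]
      have h3 : (((n % m).toNat : ℕ) : 𝓞 L) = (n : 𝓞 L) - (m : 𝓞 L) * ((n / m : ℤ) : 𝓞 L) := by
        have : (((n % m).toNat : ℕ) : ℤ) = n - m * (n / m) := by
          rw [Int.toNat_of_nonneg h1, Int.emod_def]
        have h4 := congrArg (Int.cast : ℤ → 𝓞 L) this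
        push_cast at h4
        simpa using h4
      simp only
      rw [h3]
      have : x - ((n : 𝓞 L) - (m : 𝓞 L) * ((n / m : ℤ) : 𝓞 L)) =
        (x - n) + (m : 𝓞 L) * ((n / m : ℤ) : 𝓞 L) := by ring
      rw [this]
      exact dvd_add hn (d2.mul_right _)
    have := Nat.card_le_card_of_surjective _ hsurj
    simpa using this
  obtain ⟨γ, hγ⟩ := hdiv
  have hn := congrArg (fun x => (Algebra.norm ℤ x).natAbs) hγ
  simp only [map_pow, map_mul, Int.natAbs_mul, Int.natAbs_pow, hN] at hn
  have hδ0 : δ ≠ 0 := by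
    rintro rfl
    have : (m : 𝓞 L) = 0 := by simpa using d2
    exact hm (by exact_mod_cast this)
  have hγ1 : (Algebra.norm ℤ γ).natAbs = 1 := by
    have hpos : 0 < (Algebra.norm ℤ γ).natAbs := by
      rw [Int.natAbs_pos, Algebra.norm_ne_zero_iff]
      rintro rfl
      rw [mul_zero] at hγ
      exact hδ0 (by simpa using hγ)
    have h5 : (Algebra.norm ℤ δ).natAbs ^ 2 ≤ m ^ 2 := Nat.pow_le_pow_left hcard 2
    have h6 : 0 < m ^ 2 := by positivity
    nlinarith
  have hγu : IsUnit γ := by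
    rw [← Ideal.absNorm_span_singleton, Ideal.absNorm_eq_one_iff] at hγ1
    exact Ideal.span_singleton_eq_top.mp hγ1
  obtain ⟨v, rfl⟩ := hγu
  refine ⟨v⁻¹, δ, ?_⟩
  rw [hγ]
  have : ((v⁻¹ : (𝓞 L)ˣ) : 𝓞 L) * (v : 𝓞 L) = 1 := by simp
  linear_combination (-β) * this
end units
end Cub
end

section
namespace Cub
open Module NumberField
section gen2
variable {L : Type*} [Field L] [NumberField L] {p q r : ℤ} {w : L} (b : Basis (Fin 3) ℚ L)

theorem isIntegral_w (hw : w ^ 3 = p * w ^ 2 + q * w + r) : IsIntegral ℤ w := by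
  refine ⟨Polynomial.X ^ 3 - (Polynomial.C p * Polynomial.X ^ 2 + Polynomial.C q * Polynomial.X
    + Polynomial.C r), ?_, ?_⟩
  · apply Polynomial.monic_X_pow_sub
    compute_degree
    norm_num
  · simp only [Polynomial.eval₂_sub, Polynomial.eval₂_add, Polynomial.eval₂_mul,
      Polynomial.eval₂_pow, Polynomial.eval₂_X, Polynomial.eval₂_C, hw]
    simp

theorem isIntegral_el (hw : w ^ 3 = p * w ^ 2 + q * w + r) (x y z : ℤ) :
    IsIntegral ℤ (el w x y z) := by
  have h := isIntegral_w hw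
  have hz : ∀ n : ℤ, IsIntegral ℤ ((n : ℚ) : L) := fun n => by
    simpa using isIntegral_algebraMap (R := ℤ) (A := L) (x := n)
  exact ((hz x).add ((hz y).mul h)).add ((hz z).mul (h.pow 2))

theorem discr_of_max (h0 : b 0 = 1) (h1 : b 1 = w) (h2 : b 2 = w ^ 2)
    (hw : w ^ 3 = p * w ^ 2 + q * w + r)
    (hmax : ∀ u : L, IsIntegral ℤ u → ∃ x y z : ℤ, u = el w x y z) :
    discr L = p ^ 2 * q ^ 2 + 4 * q ^ 3 - 4 * p ^ 3 * r - 27 * r ^ 2 - 18 * p * q * r := by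
  have hb : ∀ j, IsIntegral ℤ (b j) := by
    have h := isIntegral_w hw
    intro j
    fin_cases j
    · simpa [h0] using isIntegral_one
    · simpa [h1] using h
    · simpa [h2] using h.pow 2
  have hwq : w ^ 3 = ((p : ℚ) : L) * w ^ 2 + ((q : ℚ) : L) * w + ((r : ℚ) : L) := by
    simpa using hw
  have key : Algebra.discr ℚ b = (discr L : ℚ) := by
    rw [coe_discr]
    have e1 : finrank ℚ L = 3 := by simpa using finrank_eq_card_basis b
    have e2 : finrank ℤ (𝓞 L) = 3 := by rw [RingOfIntegers.rank, e1]
    let σ : (Free.ChooseBasisIndex ℤ (𝓞 L)) ≃ Fin 3 :=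
      Fintype.equivFinOfCardEq (by rw [← finrank_eq_card_chooseBasisIndex, e2])
    let b' : Basis (Fin 3) ℚ L := (integralBasis L).reindex σ
    have hb' : Algebra.discr ℚ b' = Algebra.discr ℚ (integralBasis L) := by
      simp [b', Algebra.discr_reindex]
    rw [← hb']
    apply Algebra.discr_eq_discr_of_toMatrix_coeff_isIntegral
    · intro i j
      rw [Basis.toMatrix_apply]
      have : IsIntegral ℤ (b' j) := by
        simp only [b', Basis.reindex_apply, integralBasis_apply]
        exact RingOfIntegers.isIntegral_coe _
      obtain ⟨x, y, z, hx⟩ := hmax _ this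
      rw [hx, repr_el b h0 h1 h2]
      fin_cases i
      · simpa using isIntegral_algebraMap (R := ℤ) (A := ℚ) (x := x)
      · simpa using isIntegral_algebraMap (R := ℤ) (A := ℚ) (x := y)
      · simpa using isIntegral_algebraMap (R := ℤ) (A := ℚ) (x := z)
    · intro i j
      rw [Basis.toMatrix_apply]
      simp only [b', Basis.repr_reindex_apply]
      obtain ⟨v, hv⟩ : ∃ v : 𝓞 L, (algebraMap (𝓞 L) L) v = b j := ⟨⟨b j, hb j⟩, rfl⟩
      rw [← hv, integralBasis_repr_apply]
      exact isIntegral_algebraMap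
  have e0 : b 0 = el w 1 0 0 := by simp [el, h0]
  have e1 : b 1 = el w 0 1 0 := by simp [el, h1]
  have e2 : b 2 = el w 0 0 1 := by simp [el, h2]
  have hq : (discr L : ℚ) = p ^ 2 * q ^ 2 + 4 * q ^ 3 - 4 * p ^ 3 * r - 27 * r ^ 2 - 18 * p * q * r := by
    rw [← key, Algebra.discr_def, Matrix.det_fin_three]
    simp only [Algebra.traceMatrix_apply, Algebra.traceForm_apply, e0, e1, e2, el_mul hwq,
      trace_el b h0 h1 h2 hwq]
    ring
  exact_mod_cast hq

theorem int_of_isIntegral {x : ℚ} (h : IsIntegral ℤ x) : ∃ n : ℤ, x = n := by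
  obtain ⟨n, hn⟩ := IsIntegrallyClosed.isIntegral_iff.1 h
  exact ⟨n, by simpa using hn.symm⟩

theorem max_aux (b : Basis (Fin 3) ℚ L) (h0 : b 0 = 1) (h1 : b 1 = w) (h2 : b 2 = w ^ 2)
    (hw : w ^ 3 = p * w ^ 2 + q * w + r) {x y z : ℚ} (hu : IsIntegral ℤ (el w x y z)) :
    ∃ T0 T1 T2 T3 N : ℤ,
      3 * x + p * y + (p ^ 2 + 2 * q) * z = T0 ∧
      p * x + (p ^ 2 + 2 * q) * y + (p ^ 3 + 3 * p * q + 3 * r) * z = T1 ∧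
      (p ^ 2 + 2 * q) * x + (p ^ 3 + 3 * p * q + 3 * r) * y
        + (p ^ 4 + 4 * p ^ 2 * q + 4 * p * r + 2 * q ^ 2) * z = T2 ∧
      x * T0 + y * T1 + z * T2 = T3 ∧
      (x * ((x + z * q) * (x + z * q + (y + z * p) * p) - (z * r + (y + z * p) * q) * (y + z * p))
      - z * r * (y * (x + z * q + (y + z * p) * p) - (z * r + (y + z * p) * q) * z)
      + (y + z * p) * r * (y * (y + z * p) - (x + z * q) * z)) = N := by
  have hwq : w ^ 3 = ((p : ℚ) : L) * w ^ 2 + ((q : ℚ) : L) * w + ((r : ℚ) : L) := by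
    simpa using hw
  have hi := isIntegral_w hw
  have ew : w = el w 0 1 0 := by simp [el]
  have ew2 : w ^ 2 = el w 0 0 1 := by simp [el]
  obtain ⟨T0, hT0⟩ := int_of_isIntegral (Algebra.isIntegral_trace (L := ℚ) hu)
  obtain ⟨T1, hT1⟩ := int_of_isIntegral (Algebra.isIntegral_trace (L := ℚ) (hu.mul hi))
  obtain ⟨T2, hT2⟩ := int_of_isIntegral (Algebra.isIntegral_trace (L := ℚ) (hu.mul (hi.pow 2)))
  obtain ⟨T3, hT3⟩ := int_of_isIntegral (Algebra.isIntegral_trace (L := ℚ) (hu.mul hu))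
  obtain ⟨N, hN⟩ := int_of_isIntegral (Algebra.isIntegral_norm ℚ hu)
  rw [trace_el b h0 h1 h2 hwq] at hT0
  rw [show el w x y z * w = el w x y z * el w 0 1 0 by rw [← ew], el_mul hwq,
    trace_el b h0 h1 h2 hwq] at hT1
  rw [ew2, el_mul hwq, trace_el b h0 h1 h2 hwq] at hT2
  rw [el_mul hwq, trace_el b h0 h1 h2 hwq] at hT3
  rw [norm_el b h0 h1 h2 hwq] at hN
  refine ⟨T0, T1, T2, T3, N, hT0, ?_, ?_, ?_, hN⟩
  · rw [← hT1]; ring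
  · rw [← hT2]; ring
  · rw [← hT3, ← hT0, ← hT1, ← hT2]; ring
end gen2

/-- the norm form of the two cubic fields -/
def nf (p q r x y z : ℤ) : ℤ :=
  (x * ((x + z * q) * (x + z * q + (y + z * p) * p) - (z * r + (y + z * p) * q) * (y + z * p))
      - z * r * (y * (x + z * q + (y + z * p) * p) - (z * r + (y + z * p) * q) * z)
      + (y + z * p) * r * (y * (y + z * p) - (x + z * q) * z))

theorem even_of_nf {p q r x y z N : ℤ} (hpqr : (p = -2 ∧ q = -2 ∧ r = -2) ∨ (p = 0 ∧ q = 2 ∧ r = 2))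
    (h : nf p q r (2 * x) y z = 8 * N) : (2 : ℤ) ∣ y ∧ (2 : ℤ) ∣ z := by
  have hy : (2 : ℤ) ∣ y := by
    apply Int.prime_two.dvd_of_dvd_pow (n := 3)
    rcases hpqr with ⟨rfl, rfl, rfl⟩ | ⟨rfl, rfl, rfl⟩
    · refine ⟨z^3-y*z^2+y^2*z-2*x*z^2+x*y*z+x*y^2-2*x^2*y+2*x^3-2*N, ?_⟩
      simp only [nf] at h
      linarith
    · refine ⟨2*N-z^3+y*z^2-2*x*z^2+3*x*y*z+x*y^2-4*x^2*z-2*x^3, ?_⟩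
      simp only [nf] at h
      linarith
  refine ⟨hy, ?_⟩
  obtain ⟨s, rfl⟩ := hy
  apply Int.prime_two.dvd_of_dvd_pow (n := 3)
  rcases hpqr with ⟨rfl, rfl, rfl⟩ | ⟨rfl, rfl, rfl⟩
  · refine ⟨N-(-s*z^2+2*s^2*z-2*s^3-x*z^2+x*s*z+2*x*s^2-2*x^2*s+x^3), ?_⟩
    simp only [nf] at h
    linarith
  · refine ⟨N-(-s*z^2+2*s^3+x*z^2-3*x*s*z-2*x*s^2+2*x^2*z+x^3), ?_⟩
    simp only [nf] at h
    linarith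

section max
variable {L : Type*} [Field L] [NumberField L] {p q r : ℤ} {w : L} (b : Basis (Fin 3) ℚ L)

theorem ringOfIntegers_max
    (hpqr : (p = -2 ∧ q = -2 ∧ r = -2) ∨ (p = 0 ∧ q = 2 ∧ r = 2))
    (h0 : b 0 = 1) (h1 : b 1 = w) (h2 : b 2 = w ^ 2)
    (hw : w ^ 3 = p * w ^ 2 + q * w + r) (u : L) (hu : IsIntegral ℤ u) :
    ∃ x y z : ℤ, u = el w x y z := by
  obtain ⟨x, y, z, rfl⟩ := el_surj b h0 h1 h2 u
  obtain ⟨T0, T1, T2, T3, N, e0, e1, e2, e3, eN⟩ := max_aux b h0 h1 h2 hw hu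
  have key : ∃ k Y Z : ℤ, x = k ∧ 2 * y = Y ∧ 2 * z = Z := by
    rcases hpqr with ⟨rfl, rfl, rfl⟩ | ⟨rfl, rfl, rfl⟩
    · push_cast at e0 e1 e2
      have hsq : T0^2-8*T0*T1-2*T0*T2-6*T1^2-3*T1*T2+T2^2 = 11*T3 := by
        have : (T0:ℚ)^2-8*T0*T1-2*T0*T2-6*T1^2-3*T1*T2+T2^2 = 11*T3 := by
          rw [← e3, ← e0, ← e1, ← e2]; ring
        exact_mod_cast this
      have hd : (11 : ℤ) ∣ T0 - 4 * T1 - T2 := by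
        apply (show Prime (11 : ℤ) by norm_num).dvd_of_dvd_pow (n := 2)
        exact ⟨T3 + 2 * T1 ^ 2 + T1 * T2, by linarith⟩
      obtain ⟨k, hk⟩ := hd
      have hk' : (T0 : ℚ) - 4 * T1 - T2 = 11 * k := by exact_mod_cast hk
      refine ⟨k, -8 * k - 4 * T1 - T2, -2 * k - T1, ?_, ?_, ?_⟩
      · linarith
      · push_cast; linarith
      · push_cast; linarith
    · push_cast at e0 e1 e2
      have hsq : T0^2-12*T0*T1+8*T0*T2-2*T1^2+9*T1*T2-3*T2^2 = 19*T3 := by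
        have : (T0:ℚ)^2-12*T0*T1+8*T0*T2-2*T1^2+9*T1*T2-3*T2^2 = 19*T3 := by
          rw [← e3, ← e0, ← e1, ← e2]; ring
        exact_mod_cast this
      have hd : (19 : ℤ) ∣ T0 - 6 * T1 + 4 * T2 := by
        apply (show Prime (19 : ℤ) by norm_num).dvd_of_dvd_pow (n := 2)
        exact ⟨T3 + 2 * T1 ^ 2 - 3 * T1 * T2 + T2 ^ 2, by linarith⟩
      obtain ⟨k, hk⟩ := hd
      have hk' : (T0 : ℚ) - 6 * T1 + 4 * T2 = 19 * k := by exact_mod_cast hk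
      refine ⟨k, -12 * k - 4 * T1 + 3 * T2, 8 * k + 3 * T1 - 2 * T2, ?_, ?_, ?_⟩
      · linarith
      · push_cast; linarith
      · push_cast; linarith
  obtain ⟨k, Y, Z, rfl, hY, hZ⟩ := key
  have hN : nf p q r (2 * k) Y Z = 8 * N := by
    have : ((nf p q r (2 * k) Y Z : ℤ) : ℚ) = 8 * N := by
      rw [← eN]
      simp only [nf]
      push_cast
      rw [← hY, ← hZ]
      ring
    exact_mod_cast this
  obtain ⟨⟨y', rfl⟩, ⟨z', rfl⟩⟩ := even_of_nf hpqr hN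
  refine ⟨k, y', z', ?_⟩
  push_cast at hY hZ
  rw [show y = y' by linarith, show z = z' by linarith]
end max
end Cub
end

section
namespace Cub
open Module NumberField
section desc
variable {L : Type*} [Field L] [NumberField L] {p q r : ℤ} {w : L} (b : Basis (Fin 3) ℚ L)

theorem el_mul_int (hw : w ^ 3 = p * w ^ 2 + q * w + r) (x y z x' y' z' : ℤ) :
    el w x y z * el w x' y' z' =
      el w ((x * x' + r * (y * z' + z * y') + p * r * (z * z') : ℤ) : ℚ)
        ((x * y' + y * x' + q * (y * z' + z * y') + (r + p * q) * (z * z') : ℤ) : ℚ)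
        ((x * z' + y * y' + z * x' + p * (y * z' + z * y') + (q + p ^ 2) * (z * z') : ℤ) : ℚ) := by
  have hwq : w ^ 3 = ((p : ℚ) : L) * w ^ 2 + ((q : ℚ) : L) * w + ((r : ℚ) : L) := by
    simpa using hw
  rw [el_mul hwq]
  push_cast
  rfl

theorem el_inj_int (h0 : b 0 = 1) (h1 : b 1 = w) (h2 : b 2 = w ^ 2) {x y z x' y' z' : ℤ}
    (h : el w x y z = el w x' y' z') : x = x' ∧ y = y' ∧ z = z' := by
  obtain ⟨h0, h1, h2⟩ := el_inj b h0 h1 h2 h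
  exact ⟨by exact_mod_cast h0, by exact_mod_cast h1, by exact_mod_cast h2⟩

theorem norm_el_int (h0 : b 0 = 1) (h1 : b 1 = w) (h2 : b 2 = w ^ 2)
    (hw : w ^ 3 = p * w ^ 2 + q * w + r) (x y z : ℤ) :
    Algebra.norm ℚ (el w x y z) = nf p q r x y z := by
  have hwq : w ^ 3 = ((p : ℚ) : L) * w ^ 2 + ((q : ℚ) : L) * w + ((r : ℚ) : L) := by
    simpa using hw
  rw [norm_el b h0 h1 h2 hwq, nf]
  push_cast
  rfl

/-- the sign of the unit inverse -/
theorem unit_inv (hpqr : (p = -2 ∧ q = -2 ∧ r = -2) ∨ (p = 0 ∧ q = 2 ∧ r = 2))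
    (hw : w ^ 3 = p * w ^ 2 + q * w + r) (W : 𝓞 L) (hW : algebraMap (𝓞 L) L W = w) :
    ∃ e : (𝓞 L)ˣ, (e : 𝓞 L) = 1 + W := by
  suffices h : ∃ k : 𝓞 L, (1 + W) * k = 1 by
    obtain ⟨k, hk⟩ := h
    exact ⟨⟨1 + W, k, hk, by rw [mul_comm]; exact hk⟩, rfl⟩
  rcases hpqr with ⟨rfl, rfl, rfl⟩ | ⟨rfl, rfl, rfl⟩
  · refine ⟨-(W ^ 2 + W + 1), ?_⟩
    apply FaithfulSMul.algebraMap_injective (𝓞 L) L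
    push_cast at hw
    simp only [map_add, map_mul, map_neg, map_sub, map_pow, map_one, hW]
    linear_combination -hw
  · refine ⟨(W ^ 2 - W - 1), ?_⟩
    apply FaithfulSMul.algebraMap_injective (𝓞 L) L
    push_cast at hw
    simp only [map_add, map_mul, map_neg, map_sub, map_pow, map_one, hW]
    linear_combination hw

theorem descent [IsPrincipalIdealRing (𝓞 L)]
    (hpqr : (p = -2 ∧ q = -2 ∧ r = -2) ∨ (p = 0 ∧ q = 2 ∧ r = 2))
    (h0 : b 0 = 1) (h1 : b 1 = w) (h2 : b 2 = w ^ 2)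
    (hw : w ^ 3 = p * w ^ 2 + q * w + r) (W : 𝓞 L) (hW : algebraMap (𝓞 L) L W = w)
    (a0 a1 a2 m : ℤ) (o0 : Odd a0) (o1 : Even a1) (o2 : Even a2) (hm0 : m ≠ 0)
    (hm : nf p q r a0 a1 a2 = m ^ 2)
    (hZ : ∀ δ : 𝓞 L, δ ∣ a0 + a1 * W + a2 * W ^ 2 → δ ∣ (m : 𝓞 L) → ∃ n : ℤ, δ ∣ W - n) :
    ∃ A B C : ℤ,
      a0 = A ^ 2 + 2 * r * (B * C) + p * r * C ^ 2 ∧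
      a1 = 2 * (A * B) + 2 * q * (B * C) + (r + p * q) * C ^ 2 ∧
      a2 = 2 * (A * C) + B ^ 2 + 2 * p * (B * C) + (q + p ^ 2) * C ^ 2 := by
  have hcoords : ∀ u : 𝓞 L, ∃ x y z : ℤ, algebraMap (𝓞 L) L u = el w x y z := fun u =>
    ringOfIntegers_max b hpqr h0 h1 h2 hw u (RingOfIntegers.isIntegral_coe u)
  have hf : finrank ℚ L = 3 := by simpa using finrank_eq_card_basis b
  have hd : discr L < 0 := by
    rw [discr_of_max b h0 h1 h2 hw (ringOfIntegers_max b hpqr h0 h1 h2 hw)]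
    rcases hpqr with ⟨rfl, rfl, rfl⟩ | ⟨rfl, rfl, rfl⟩ <;> norm_num
  have hp : Even p := by
    rcases hpqr with ⟨rfl, rfl, rfl⟩ | ⟨rfl, rfl, rfl⟩ <;> decide
  have hq : Even q := by
    rcases hpqr with ⟨rfl, rfl, rfl⟩ | ⟨rfl, rfl, rfl⟩ <;> decide
  have hr : Even r := by
    rcases hpqr with ⟨rfl, rfl, rfl⟩ | ⟨rfl, rfl, rfl⟩ <;> decide
  set β : 𝓞 L := a0 + a1 * W + a2 * W ^ 2 with hβ
  have hβel : algebraMap (𝓞 L) L β = el w a0 a1 a2 := by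
    rw [hβ]; simp [el, hW]
  have hNq : Algebra.norm ℚ (algebraMap (𝓞 L) L β) = m ^ 2 := by
    rw [hβel, norm_el_int b h0 h1 h2 hw, hm]; push_cast; rfl
  have hN : Algebra.norm ℤ β = m ^ 2 := by
    have := Algebra.coe_norm_int (K := L) β
    rw [hNq] at this
    exact_mod_cast this
  obtain ⟨e, he⟩ := unit_inv hpqr hw W hW
  have sq1 : ∀ A B C : ℤ, el w A B C ^ 2 = el w ((A ^ 2 + 2 * r * (B * C) + p * r * C ^ 2 : ℤ) : ℚ)
      ((2 * (A * B) + 2 * q * (B * C) + (r + p * q) * C ^ 2 : ℤ) : ℚ)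
      ((2 * (A * C) + B ^ 2 + 2 * p * (B * C) + (q + p ^ 2) * C ^ 2 : ℤ) : ℚ) := by
    intro A B C
    rw [pow_two, el_mul_int hw]
    congr 2 <;> ring
  have hnegel : ∀ A B C : ℤ, - el w A B C = el w ((-A : ℤ) : ℚ) ((-B : ℤ) : ℚ) ((-C : ℤ) : ℚ) := by
    intro A B C; simp [el]; ring
  have heL : algebraMap (𝓞 L) L e = el w ((1 : ℤ) : ℚ) ((1 : ℤ) : ℚ) ((0 : ℤ) : ℚ) := by
    rw [he]; simp [el, hW]
  have hc1 : ∀ A B C : ℤ, Even (2 * (A * B) + 2 * q * (B * C) + (r + p * q) * C ^ 2) := by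
    intro A B C
    obtain ⟨q', rfl⟩ := hq
    obtain ⟨r', rfl⟩ := hr
    exact ⟨A * B + 2 * q' * (B * C) + (r' + p * q') * C ^ 2, by ring⟩
  have he1 : ∀ v : (𝓞 L)ˣ, e ≠ v ^ 2 := by
    intro v hv
    obtain ⟨A, B, C, hA⟩ := hcoords v
    have : algebraMap (𝓞 L) L e = algebraMap (𝓞 L) L v ^ 2 := by rw [hv]; simp
    rw [heL, hA, sq1] at this
    have h := (el_inj_int b h0 h1 h2 this).2.1
    have := hc1 A B C
    rw [← h] at this
    revert this; decide
  have he2 : ∀ v : (𝓞 L)ˣ, e ≠ - v ^ 2 := by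
    intro v hv
    obtain ⟨A, B, C, hA⟩ := hcoords v
    have : algebraMap (𝓞 L) L e = - algebraMap (𝓞 L) L v ^ 2 := by rw [hv]; simp
    rw [heL, hA, sq1, hnegel] at this
    have h := (el_inj_int b h0 h1 h2 this).2.1
    have := (hc1 A B C).neg
    rw [← h] at this
    revert this; decide
  have hmul1 : ∀ t : 𝓞 L, (algebraMap (𝓞 L) L β = algebraMap (𝓞 L) L e * algebraMap (𝓞 L) L t ^ 2 ∨ algebraMap (𝓞 L) L β = - (algebraMap (𝓞 L) L e * algebraMap (𝓞 L) L t ^ 2)) → False := by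
    intro t ht
    obtain ⟨A, B, C, hA⟩ := hcoords t
    rw [hβel, heL, hA, sq1, el_mul_int hw, hnegel] at ht
    have key : ∀ c0 c1 c2 : ℤ, Even c1 → Odd (1 * c0 + r * (1 * c2 + 0 * c1) + p * r * (0 * c2)) →
        Even (1 * c1 + 1 * c0 + q * (1 * c2 + 0 * c1) + (r + p * q) * (0 * c2)) → False := by
      intro c0 c1 c2 f1 f2 f3
      simp only [Int.even_add, Int.even_mul, ← Int.not_even_iff_odd, hp, hq, hr, f1] at f2 f3
      simp at f2 f3
      exact (Int.not_even_iff_odd.2 f2) f3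
    rcases ht with ht | ht
    · obtain ⟨e0, e1, e2⟩ := el_inj_int b h0 h1 h2 ht
      rw [e0] at o0
      rw [e1] at o1
      exact key _ _ _ (hc1 A B C) o0 o1
    · obtain ⟨e0, e1, e2⟩ := el_inj_int b h0 h1 h2 ht
      rw [e0] at o0
      rw [e1] at o1
      exact key _ _ _ (hc1 A B C) (by simpa using o0.neg) (by simpa using o1.neg)
  have hunit : ∃ (u : (𝓞 L)ˣ) (δ : 𝓞 L), β = u * δ ^ 2 := by
    apply unit_mul_sq β m.natAbs (by simpa using hm0)
    · rw [hN, Int.natAbs_pow]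
    · have := Ideal.absNorm_mem (Ideal.span {β})
      rw [Ideal.mem_span_singleton, Ideal.absNorm_span_singleton, hN, Int.natAbs_pow] at this
      simpa using this
    · intro δ d1 d2 x
      have d3 : δ ∣ (m : 𝓞 L) := by
        refine d2.trans ?_
        rcases Int.natAbs_eq m with h | h
        · rw [h]; simp
        · rw [h]; simp
      obtain ⟨n, k, hk⟩ := hZ δ d1 d3
      obtain ⟨A, B, C, hA⟩ := hcoords x
      have hx : x = A + B * W + C * W ^ 2 := by
        apply FaithfulSMul.algebraMap_injective (𝓞 L) L
        rw [hA]; simp [el, hW]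
      refine ⟨A + B * n + C * n ^ 2, ⟨k * (B + C * (W + n)), ?_⟩⟩
      rw [hx]; push_cast
      linear_combination (B + C * (W + n)) * hk
  obtain ⟨u, δ, hu⟩ := hunit
  obtain ⟨v, hv⟩ := units_mod_sq hf hd e he1 he2 u
  have hu' : algebraMap (𝓞 L) L β = algebraMap (𝓞 L) L u * algebraMap (𝓞 L) L δ ^ 2 := by rw [hu]; simp
  rcases hv with rfl | rfl | rfl | rfl
  · obtain ⟨A, B, C, hA⟩ := hcoords (v * δ)
    have : algebraMap (𝓞 L) L β = algebraMap (𝓞 L) L (v * δ) ^ 2 := by rw [hu']; simp only [Units.val_pow_eq_pow_val, Units.val_mul, Units.val_neg, map_mul, map_pow, map_neg]; ring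
    rw [hβel, hA, sq1] at this
    exact ⟨A, B, C, el_inj_int b h0 h1 h2 this⟩
  · exfalso
    have : algebraMap (𝓞 L) L β = - algebraMap (𝓞 L) L (v * δ) ^ 2 := by rw [hu']; simp only [Units.val_pow_eq_pow_val, Units.val_mul, Units.val_neg, map_mul, map_pow, map_neg]; ring
    rw [this, ← neg_one_mul, map_mul, map_pow] at hNq
    have h3 : Algebra.norm ℚ (-1 : L) = -1 := by
      have := Algebra.norm_algebraMap (S := L) (-1 : ℚ)
      rw [hf, map_neg, map_one] at this
      rw [this]; norm_num
    rw [h3] at hNq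
    have : (0 : ℚ) < m ^ 2 := by positivity
    nlinarith [sq_nonneg ((Algebra.norm ℚ) (algebraMap (𝓞 L) L (v * δ)))]
  · exfalso
    apply hmul1 (v * δ)
    left
    rw [hu']; simp only [Units.val_pow_eq_pow_val, Units.val_mul, Units.val_neg, map_mul, map_pow, map_neg]; ring
  · exfalso
    apply hmul1 (v * δ)
    right
    rw [hu']; simp only [Units.val_pow_eq_pow_val, Units.val_mul, Units.val_neg, map_mul, map_pow, map_neg]; ring

end desc
end Cub
end

section
namespace Cub
open Module NumberField
section pid
variable {L : Type*} [Field L] [NumberField L] {p q r : ℤ} {w : L} (b : Basis (Fin 3) ℚ L)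

theorem isPID (hpqr : (p = -2 ∧ q = -2 ∧ r = -2) ∨ (p = 0 ∧ q = 2 ∧ r = 2))
    (h0 : b 0 = 1) (h1 : b 1 = w) (h2 : b 2 = w ^ 2)
    (hw : w ^ 3 = p * w ^ 2 + q * w + r) : IsPrincipalIdealRing (𝓞 L) := by
  have hf : finrank ℚ L = 3 := by simpa using finrank_eq_card_basis b
  have hd := discr_of_max b h0 h1 h2 hw (ringOfIntegers_max b hpqr h0 h1 h2 hw)
  have hd' : discr L < 0 ∧ |discr L| ≤ 76 := by
    rw [hd]
    rcases hpqr with ⟨rfl, rfl, rfl⟩ | ⟨rfl, rfl, rfl⟩ <;> norm_num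
  have hc : InfinitePlace.nrRealPlaces L + 2 * InfinitePlace.nrComplexPlaces L = 3 := by
    rw [InfinitePlace.card_add_two_mul_card_eq_rank, hf]
  have hs := sign_discr L
  rw [Int.sign_eq_neg_one_of_neg hd'.1] at hs
  have hr2 : InfinitePlace.nrComplexPlaces L = 1 := by
    have : InfinitePlace.nrComplexPlaces L ≠ 0 := by
      intro h
      rw [h] at hs
      norm_num at hs
    omega
  have hW := isIntegral_w hw
  set W : 𝓞 L := ⟨w, hW⟩ with hWdef
  have hWw : algebraMap (𝓞 L) L W = w := rfl
  have hNW : (Algebra.norm ℤ W).natAbs = 2 := by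
    have : ((Algebra.norm ℤ W : ℤ) : ℚ) = Algebra.norm ℚ (algebraMap (𝓞 L) L W) :=
      Algebra.coe_norm_int (K := L) W
    have e : algebraMap (𝓞 L) L W = el w ((0 : ℤ) : ℚ) ((1 : ℤ) : ℚ) ((0 : ℤ) : ℚ) := by
      rw [hWw]; simp [el]
    rw [e, norm_el_int b h0 h1 h2 hw] at this
    have h : Algebra.norm ℤ W = nf p q r 0 1 0 := by exact_mod_cast this
    rw [h]
    rcases hpqr with ⟨rfl, rfl, rfl⟩ | ⟨rfl, rfl, rfl⟩ <;> simp [nf]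
  have hW3 : ∃ k : 𝓞 L, W ^ 3 = 2 * k := by
    rcases hpqr with ⟨rfl, rfl, rfl⟩ | ⟨rfl, rfl, rfl⟩
    · refine ⟨- W ^ 2 - W - 1, ?_⟩
      apply FaithfulSMul.algebraMap_injective (𝓞 L) L
      push_cast at hw
      simp only [map_add, map_mul, map_neg, map_sub, map_pow, map_one, hWw, hw, map_ofNat]
      ring
    · refine ⟨W + 1, ?_⟩
      apply FaithfulSMul.algebraMap_injective (𝓞 L) L
      push_cast at hw
      simp only [map_add, map_mul, map_neg, map_sub, map_pow, map_one, hWw, hw, map_ofNat]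
      ring
  apply RingOfIntegers.isPrincipalIdealRing_of_isPrincipal_of_norm_le_of_isPrime
  intro I hI hle
  have hlt : Ideal.absNorm (I : Ideal (𝓞 L)) < 3 := by
    have : (Ideal.absNorm (I : Ideal (𝓞 L)) : ℝ) < 3 := by
      refine lt_of_le_of_lt hle ?_
      rw [hr2, hf]
      have hs : √(|discr L| : ℝ) ≤ 8.75 := by
        rw [Real.sqrt_le_left (by norm_num)]
        have : ((|discr L| : ℤ) : ℝ) ≤ 76 := by exact_mod_cast hd'.2
        rw [Int.cast_abs] at this
        refine this.trans (by norm_num)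
      have hpi : 4 / Real.pi < 1.28 := by
        rw [div_lt_iff₀ Real.pi_pos]
        nlinarith [Real.pi_gt_d2]
      have h0 : 0 < 4 / Real.pi := by positivity
      have e : (Nat.factorial 3 : ℝ) = 6 := by norm_num [Nat.factorial]
      rw [e, pow_one]
      push_cast
      have := Real.sqrt_nonneg |(discr L : ℝ)|
      nlinarith
    exact_mod_cast this
  have hne : Ideal.absNorm (I : Ideal (𝓞 L)) ≠ 0 := Ideal.absNorm_ne_zero_of_nonZeroDivisors I
  have hne1 : Ideal.absNorm (I : Ideal (𝓞 L)) ≠ 1 := by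
    rw [Ne, Ideal.absNorm_eq_one_iff]
    exact hI.ne_top
  have h2' : Ideal.absNorm (I : Ideal (𝓞 L)) = 2 := by omega
  have hmem : W ∈ (I : Ideal (𝓞 L)) := by
    apply hI.mem_of_pow_mem 3
    obtain ⟨k, hk⟩ := hW3
    rw [hk]
    apply Ideal.mul_mem_right
    have := Ideal.absNorm_mem (I : Ideal (𝓞 L))
    rw [h2'] at this
    simpa using this
  have hdv : (I : Ideal (𝓞 L)) ∣ Ideal.span {W} := by
    rw [Ideal.dvd_span_singleton]
    exact hmem
  obtain ⟨J, hJ⟩ := hdv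
  have h3 := congrArg Ideal.absNorm hJ
  rw [map_mul, h2', Ideal.absNorm_span_singleton, hNW] at h3
  have h4 : Ideal.absNorm J = 1 := by omega
  rw [Ideal.absNorm_eq_one_iff] at h4
  rw [h4, Ideal.mul_top] at hJ
  rw [← hJ]
  exact ⟨W, rfl⟩
end pid

section inst
open Polynomial

theorem field_exists (p q r : ℤ) (hpqr : (p = -2 ∧ q = -2 ∧ r = -2) ∨ (p = 0 ∧ q = 2 ∧ r = 2)) :
    ∃ (L : Type) (_ : Field L) (_ : NumberField L) (w : L) (b : Basis (Fin 3) ℚ L),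
      b 0 = 1 ∧ b 1 = w ∧ b 2 = w ^ 2 ∧ w ^ 3 = p * w ^ 2 + q * w + r := by
  set f : ℤ[X] := X ^ 3 - (C p * X ^ 2 + C q * X + C r) with hf
  have hdeg2 : (C p * X ^ 2 + C q * X + C r).degree < ((3 : ℕ) : WithBot ℕ) := by
    compute_degree
    norm_num
  have hmon : f.Monic := monic_X_pow_sub (by simpa using hdeg2)
  have hnd : f.natDegree = 3 := by
    rw [hf, natDegree_sub_eq_left_of_natDegree_lt]
    · simp
    · rw [natDegree_X_pow]
      refine lt_of_le_of_lt (b := 2) ?_ (by norm_num)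
      compute_degree
  have heis : f.IsEisensteinAt (Ideal.span {(2 : ℤ)}) := by
    refine ⟨?_, ?_, ?_⟩
    · rw [hmon.leadingCoeff, Ideal.mem_span_singleton]; norm_num
    · intro n hn
      rw [hnd] at hn
      rw [Ideal.mem_span_singleton]
      rcases hpqr with ⟨rfl, rfl, rfl⟩ | ⟨rfl, rfl, rfl⟩ <;> interval_cases n <;>
        simp [hf, coeff_X, coeff_C, coeff_one, coeff_X_pow]
    · rw [Ideal.span_singleton_pow, Ideal.mem_span_singleton]
      rcases hpqr with ⟨rfl, rfl, rfl⟩ | ⟨rfl, rfl, rfl⟩ <;>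
        simp [hf, coeff_X, coeff_C, coeff_one, coeff_X_pow] <;> decide
  have hirrZ : Irreducible f := heis.irreducible
    ((Ideal.span_singleton_prime (by norm_num)).2 Int.prime_two) hmon.isPrimitive (by omega)
  set g : ℚ[X] := f.map (algebraMap ℤ ℚ) with hg
  have hgm : g.Monic := hmon.map _
  have hirr : Irreducible g := (hmon.irreducible_iff_irreducible_map_fraction_map).1 hirrZ
  have hgn : g.natDegree = 3 := by rw [hg, hmon.natDegree_map, hnd]
  haveI : Fact (Irreducible g) := ⟨hirr⟩
  let pb := AdjoinRoot.powerBasis hirr.ne_zero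
  have hdim : pb.dim = 3 := by rw [AdjoinRoot.powerBasis_dim, hgn]
  let L := AdjoinRoot g
  haveI : FiniteDimensional ℚ L := pb.finite
  haveI : CharZero L := charZero_of_injective_algebraMap (algebraMap ℚ L).injective
  haveI : NumberField L := {}
  let b : Basis (Fin 3) ℚ L := pb.basis.reindex (finCongr hdim)
  have hb : ∀ i : Fin 3, b i = (AdjoinRoot.root g : L) ^ (i : ℕ) := by
    intro i
    simp [b, PowerBasis.basis_eq_pow, pb, AdjoinRoot.powerBasis_gen]
  refine ⟨L, inferInstance, inferInstance, AdjoinRoot.root g, b, by simp [hb], by simp [hb],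
    by simp [hb], ?_⟩
  have hge : g = X ^ 3 - (C (p : ℚ) * X ^ 2 + C (q : ℚ) * X + C (r : ℚ)) := by
    rw [hg, hf]; simp
  have h : eval₂ (AdjoinRoot.of g) (AdjoinRoot.root g)
      (X ^ 3 - (C (p : ℚ) * X ^ 2 + C (q : ℚ) * X + C (r : ℚ))) = 0 := by
    rw [← hge]; exact AdjoinRoot.eval₂_root g
  simp only [eval₂_sub, eval₂_add, eval₂_mul, eval₂_pow, eval₂_X, eval₂_C] at h
  simp only [map_intCast] at h
  exact sub_eq_zero.1 h

end inst
end Cub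
end

section
namespace Cub
open Module NumberField

theorem desc11 (a D m : ℤ) (hc : IsCoprime a (2 * D)) (hm : a ^ 3 - 4 * a ^ 2 * D + 16 * D ^ 3 = m ^ 2) :
    ∃ A B C : ℤ, a = A ^ 2 - 4 * (B * C) + 4 * C ^ 2 ∧ 2 * D = 2 * (A * B) - 4 * (B * C) + 2 * C ^ 2
      ∧ 2 * D = 2 * (A * C) + B ^ 2 - 4 * (B * C) + 2 * C ^ 2 := by
  have hpqr : ((-2 : ℤ) = -2 ∧ (-2 : ℤ) = -2 ∧ (-2 : ℤ) = -2) ∨ ((-2 : ℤ) = 0 ∧ (-2 : ℤ) = 2 ∧ (-2 : ℤ) = 2) :=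
    Or.inl ⟨rfl, rfl, rfl⟩
  obtain ⟨L, _, _, w, b, h0, h1, h2, hw⟩ := field_exists (-2) (-2) (-2) hpqr
  haveI := isPID b hpqr h0 h1 h2 hw
  have hodd : Odd a := by
    rw [← Int.not_even_iff_odd, even_iff_two_dvd]
    intro h
    have := hc.isUnit_of_dvd' h (Dvd.intro _ rfl)
    revert this; rw [Int.isUnit_iff]; decide
  have hcm : IsCoprime m (2 * D) := by
    have : IsCoprime (m ^ 2) (2 * D) := by
      have h := (hc.pow_left (m := 3)).add_mul_left_left (- 2 * a ^ 2 + 8 * D ^ 2)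
      have e : m ^ 2 = a ^ 3 + 2 * D * (- 2 * a ^ 2 + 8 * D ^ 2) := by rw [← hm]; ring
      rw [e]; exact h
    exact (IsCoprime.pow_left_iff (by norm_num)).1 this
  have hm0 : m ≠ 0 := by
    rintro rfl
    have : Odd ((0 : ℤ) ^ 2) := by
      rw [← hm]
      have : Even (- 4 * a ^ 2 * D + 16 * D ^ 3) := ⟨- 2 * a ^ 2 * D + 8 * D ^ 3, by ring⟩
      have h := (hodd.pow (n := 3)).add_even this
      convert h using 1; ring
    revert this; decide
  set W : 𝓞 L := ⟨w, isIntegral_w hw⟩ with hWdef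
  have hWw : algebraMap (𝓞 L) L W = w := rfl
  have hW3 : W ^ 3 = -2 * W ^ 2 - 2 * W - 2 := by
    apply FaithfulSMul.algebraMap_injective (𝓞 L) L
    push_cast at hw
    simp only [map_mul, map_neg, map_sub, map_pow, hWw, hw, map_ofNat]
    ring
  obtain ⟨A, B, C, e0, e1, e2⟩ := descent b hpqr h0 h1 h2 hw W hWw a (2 * D) (2 * D) m hodd
    ⟨D, by ring⟩ ⟨D, by ring⟩ hm0 (by rw [← hm]; simp only [nf]; ring) (by
      intro δ hδ hδm
      obtain ⟨s, t, hst⟩ := hcm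
      have hst' : (s : 𝓞 L) * m + t * (2 * D) = 1 := by exact_mod_cast congrArg (Int.cast : ℤ → 𝓞 L) hst
      refine ⟨a * t - a ^ 2 * t ^ 2, ?_⟩
      push_cast at hδ
      have h3 : δ ∣ (W + W ^ 2) + a * t := by
        have h := (hδm.mul_left (s * (W + W ^ 2))).add (hδ.mul_left (t : 𝓞 L))
        convert h using 1
        linear_combination (- (W + W ^ 2)) * hst'
      have h := h3.mul_left (-1 - ((W + W ^ 2) - a * t))
      convert h using 1
      push_cast
      linear_combination W * hW3)
  exact ⟨A, B, C, by rw [e0]; ring, by rw [e1]; ring, by rw [e2]; ring⟩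

theorem desc19 (a D m : ℤ) (hc : IsCoprime a (2 * D))
    (hm : a ^ 3 + 4 * a ^ 2 * D + 16 * a * D ^ 2 + 16 * D ^ 3 = m ^ 2) :
    ∃ A B C : ℤ, a + 4 * D = A ^ 2 + 4 * (B * C) ∧ 2 * D = 2 * (A * B) + 4 * (B * C) + 2 * C ^ 2
      ∧ - (2 * D) = 2 * (A * C) + B ^ 2 + 2 * C ^ 2 := by
  have hpqr : ((0 : ℤ) = -2 ∧ (2 : ℤ) = -2 ∧ (2 : ℤ) = -2) ∨ ((0 : ℤ) = 0 ∧ (2 : ℤ) = 2 ∧ (2 : ℤ) = 2) :=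
    Or.inr ⟨rfl, rfl, rfl⟩
  obtain ⟨L, _, _, w, b, h0, h1, h2, hw⟩ := field_exists 0 2 2 hpqr
  haveI := isPID b hpqr h0 h1 h2 hw
  have hodd : Odd a := by
    rw [← Int.not_even_iff_odd, even_iff_two_dvd]
    intro h
    have := hc.isUnit_of_dvd' h (Dvd.intro _ rfl)
    revert this; rw [Int.isUnit_iff]; decide
  have hcm : IsCoprime m (2 * D) := by
    have : IsCoprime (m ^ 2) (2 * D) := by
      have h := (hc.pow_left (m := 3)).add_mul_left_left (2 * a ^ 2 + 8 * a * D + 8 * D ^ 2)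
      have e : m ^ 2 = a ^ 3 + 2 * D * (2 * a ^ 2 + 8 * a * D + 8 * D ^ 2) := by rw [← hm]; ring
      rw [e]; exact h
    exact (IsCoprime.pow_left_iff (by norm_num)).1 this
  have hm0 : m ≠ 0 := by
    rintro rfl
    have : Odd ((0 : ℤ) ^ 2) := by
      rw [← hm]
      have : Even (4 * a ^ 2 * D + 16 * a * D ^ 2 + 16 * D ^ 3) :=
        ⟨2 * a ^ 2 * D + 8 * a * D ^ 2 + 8 * D ^ 3, by ring⟩
      have h := (hodd.pow (n := 3)).add_even this
      convert h using 1; ring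
    revert this; decide
  set W : 𝓞 L := ⟨w, isIntegral_w hw⟩ with hWdef
  have hWw : algebraMap (𝓞 L) L W = w := rfl
  have hW3 : W ^ 3 = 2 * W + 2 := by
    apply FaithfulSMul.algebraMap_injective (𝓞 L) L
    push_cast at hw
    simp only [map_mul, map_add, map_pow, hWw, hw, map_ofNat]
    ring
  obtain ⟨A, B, C, e0, e1, e2⟩ := descent b hpqr h0 h1 h2 hw W hWw (a + 4 * D) (2 * D) (- (2 * D)) m
    (hodd.add_even ⟨2 * D, by ring⟩)
    ⟨D, by ring⟩ ⟨- D, by ring⟩ hm0 (by rw [← hm]; simp only [nf]; ring) (by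
      intro δ hδ hδm
      obtain ⟨s, t, hst⟩ := hcm
      have hst' : (s : 𝓞 L) * m + t * (2 * D) = 1 := by exact_mod_cast congrArg (Int.cast : ℤ → 𝓞 L) hst
      refine ⟨(t * (a + 4 * D)) ^ 2 - 3 * (t * (a + 4 * D)) + 4, ?_⟩
      push_cast at hδ
      have h3 : δ ∣ (W ^ 2 - W) - t * (a + 4 * D) := by
        have h := (hδm.mul_left (s * (W ^ 2 - W))).sub (hδ.mul_left (t : 𝓞 L))
        convert h using 1
        linear_combination (- (W ^ 2 - W)) * hst'
      have h := h3.mul_left ((W ^ 2 - W) + t * (a + 4 * D) - 3)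
      convert h using 1
      push_cast
      linear_combination (2 - W) * hW3)
  exact ⟨A, B, C, by rw [e0]; ring, by rw [e1]; ring, by rw [e2]; ring⟩
end Cub
end

section
namespace Cub

theorem ext_aux (d k H r : ℤ) (hk : 0 < k) (hk2 : Even k) (hkH : k * H = d * r ^ 2)
    (hc : IsCoprime k H) (hd : d = 1 ∨ (d = -5 ∧ ¬ (5 : ℤ) ∣ H)) :
    ∃ e : ℤ, e ≠ 0 ∧ (k = 4 * (d * e ^ 2) ∨ k = - (4 * (d * e ^ 2))) := by
  rcases hd with rfl | ⟨rfl, h5⟩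
  · rw [one_mul] at hkH
    obtain ⟨f, hf⟩ := Int.sq_of_isCoprime hc hkH
    have hf' : k = f ^ 2 := by
      rcases hf with h | h
      · exact h
      · nlinarith [sq_nonneg f]
    have hfe : Even f := by
      rw [hf'] at hk2
      exact (Int.even_pow.1 hk2).1
    obtain ⟨e, he⟩ := hfe
    refine ⟨e, ?_, Or.inl ?_⟩
    · rintro rfl
      rw [hf', he] at hk; norm_num at hk
    · rw [hf', he]; ring
  · have p5 : Prime (5 : ℤ) := by norm_num
    have : (5 : ℤ) ∣ k := by
      have : (5 : ℤ) ∣ k * H := ⟨- r ^ 2, by rw [hkH]; ring⟩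
      exact (p5.dvd_or_dvd this).resolve_right h5
    obtain ⟨j, hj⟩ := this
    have hj0 : 0 < j := by omega
    have hjH : j * (-H) = r ^ 2 := by
      have : 5 * (j * (-H)) = 5 * r ^ 2 := by
        rw [hj] at hkH; linarith
      linarith
    have hcj : IsCoprime j (-H) := by
      rw [hj] at hc
      exact (hc.of_mul_left_right).neg_right
    obtain ⟨f, hf⟩ := Int.sq_of_isCoprime hcj hjH
    have hf' : j = f ^ 2 := by
      rcases hf with h | h
      · exact h
      · nlinarith [sq_nonneg f]
    have hfe : Even f := by
      rw [hj, hf'] at hk2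
      rcases Int.even_mul.1 hk2 with h | h
      · exact absurd h (by decide)
      · exact (Int.even_pow.1 h).1
    obtain ⟨e, he⟩ := hfe
    refine ⟨e, ?_, Or.inr ?_⟩
    · rintro rfl
      rw [hf', he] at hj0; norm_num at hj0
    · rw [hj, hf', he]; ring

/-- a rational with squarefree multiple of its square integral is integral -/
theorem int_of_sq (d : ℤ) (hd : d = 1 ∨ d = -5) (x : ℚ) (N : ℤ) (h : d * x ^ 2 = N) :
    ∃ r : ℤ, x = r := by
  have hsq : Squarefree d := by
    rcases hd with rfl | rfl
    · exact squarefree_one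
    · have : Squarefree (5 : ℤ) := (show Prime (5 : ℤ) by norm_num).squarefree
      rw [← Int.squarefree_natAbs] at this ⊢
      exact this
  have hden : (x.den : ℤ) * x.den ∣ d := by
    have h1 : d * x.num ^ 2 = N * (x.den * x.den) := by
      have hx := Rat.num_div_den x
      have hd0 : (x.den : ℚ) ≠ 0 := by exact_mod_cast x.den_nz
      rw [← hx] at h
      field_simp at h
      have h' : (d : ℚ) * x.num ^ 2 = N * (x.den * x.den) := by rw [h]; ring
      exact_mod_cast h'
    have hc : IsCoprime ((x.den : ℤ) * x.den) (x.num ^ 2) := by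
      have := (Int.isCoprime_iff_gcd_eq_one.2 (by simpa [Int.gcd] using x.reduced) : IsCoprime x.num (x.den : ℤ))
      exact (this.symm.mul_left this.symm).pow_right
    exact hc.dvd_of_dvd_mul_right ⟨N, by rw [h1]; ring⟩
  have hu := hsq _ hden
  have h1 : x.den = 1 := by
    rw [Int.isUnit_iff] at hu
    omega
  exact ⟨x.num, ((Rat.den_eq_one_iff x).1 h1).symm⟩

theorem extract (u v d : ℤ) (hd : d = 1 ∨ (d = -5 ∧ ∀ n k : ℤ,
      (5 : ℤ) ∣ 4 * n ^ 3 + 4 * u * n ^ 2 * k + 4 * v * n * k ^ 2 + k ^ 3 → (5 : ℤ) ∣ n ∧ (5 : ℤ) ∣ k))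
    (x w : ℚ) (h : d * w ^ 2 = 4 * x ^ 3 + 4 * u * x ^ 2 + 4 * v * x + 1) (hx : 2 ∣ x.den) :
    ∃ a e m : ℤ, e ≠ 0 ∧ x * (4 * (d * e ^ 2)) = a ∧ ((x.den : ℤ) ∣ 4 * (d * e ^ 2)) ∧
      (4 * (d * e ^ 2) ∣ (x.den : ℤ)) ∧
      IsCoprime a (2 * (d * e ^ 2)) ∧
      a ^ 3 + 4 * u * a ^ 2 * (d * e ^ 2) + 16 * v * a * (d * e ^ 2) ^ 2 + 16 * (d * e ^ 2) ^ 3 = m ^ 2 := by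
  have hd' : d = 1 ∨ d = -5 := by tauto
  have hred : IsCoprime x.num (x.den : ℤ) := Int.isCoprime_iff_gcd_eq_one.2 (by simpa [Int.gcd] using x.reduced)
  have hxk : x * x.den = x.num := Rat.mul_den_eq_num x
  have hk0 : 0 < (x.den : ℤ) := by exact_mod_cast x.den_pos
  have hk2 : (2 : ℤ) ∣ (x.den : ℤ) := by exact_mod_cast hx
  have hxk' : x * (x.den : ℤ) = x.num := by exact_mod_cast hxk
  generalize hkk : (x.den : ℤ) = k at *
  generalize x.num = n at *
  obtain ⟨k1, hk1⟩ := hk2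
  have hkq : (k : ℚ) ≠ 0 := by exact_mod_cast hk0.ne'
  have e1 : (d : ℚ) * (k ^ 2 * w) ^ 2 = ((k * (4 * n ^ 3 + 4 * u * n ^ 2 * k + 4 * v * n * k ^ 2 + k ^ 3) : ℤ) : ℚ) := by
    push_cast
    rw [← hxk']
    linear_combination (k : ℚ) ^ 4 * h
  obtain ⟨r, hr⟩ := int_of_sq d hd' _ _ e1
  rw [hr] at e1
  have e2 : d * r ^ 2 = k * (4 * n ^ 3 + 4 * u * n ^ 2 * k + 4 * v * n * k ^ 2 + k ^ 3) := by exact_mod_cast e1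
  have hre : Even r := by
    have : Even (d * r ^ 2) := by rw [e2, hk1]; exact ⟨k1 * (4 * n ^ 3 + 4 * u * n ^ 2 * (2 * k1) + 4 * v * n * (2 * k1) ^ 2 + (2 * k1) ^ 3), by ring⟩
    rcases Int.even_mul.1 this with h | h
    · exfalso; rcases hd' with rfl | rfl <;> revert h <;> decide
    · exact (Int.even_pow.1 h).1
  obtain ⟨r1, hr1⟩ := hre
  have e3 : k * (n ^ 3 + 2 * u * n ^ 2 * k1 + 4 * v * n * k1 ^ 2 + 2 * k1 ^ 3) = d * r1 ^ 2 := by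
    rw [hr1, hk1] at e2
    rw [hk1]
    have : 4 * (2 * k1 * (n ^ 3 + 2 * u * n ^ 2 * k1 + 4 * v * n * k1 ^ 2 + 2 * k1 ^ 3)) = 4 * (d * r1 ^ 2) := by
      linear_combination - e2
    linarith
  have hcH : IsCoprime k (n ^ 3 + 2 * u * n ^ 2 * k1 + 4 * v * n * k1 ^ 2 + 2 * k1 ^ 3) := by
    have h := (hred.symm.pow_right (n := 3)).add_mul_left_right (u * n ^ 2 + 2 * v * n * k1 + k1 ^ 2)
    have e : n ^ 3 + 2 * u * n ^ 2 * k1 + 4 * v * n * k1 ^ 2 + 2 * k1 ^ 3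
      = n ^ 3 + k * (u * n ^ 2 + 2 * v * n * k1 + k1 ^ 2) := by rw [hk1]; ring
    rw [e]; exact h
  obtain ⟨e, he0, he⟩ := ext_aux d k _ r1 hk0 ⟨k1, by rw [hk1]; ring⟩ e3 hcH (by
    rcases hd with h | ⟨h, h'⟩
    · exact Or.inl h
    · refine Or.inr ⟨h, fun h5 => ?_⟩
      have := h' n k (by
        obtain ⟨c, hc⟩ := h5
        refine ⟨4 * c, ?_⟩
        rw [hk1]
        linear_combination 4 * hc)
      have := hred.isUnit_of_dvd' this.1 this.2
      revert this; rw [Int.isUnit_iff]; decide)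
  have hm : ∀ a : ℤ, x * (4 * (d * e ^ 2)) = a → ∃ m : ℤ,
      a ^ 3 + 4 * u * a ^ 2 * (d * e ^ 2) + 16 * v * a * (d * e ^ 2) ^ 2 + 16 * (d * e ^ 2) ^ 3 = m ^ 2 := by
    intro a ha
    have : ((1 : ℤ) : ℚ) * (4 * d ^ 2 * e ^ 3 * w) ^ 2 = ((a ^ 3 + 4 * u * a ^ 2 * (d * e ^ 2) + 16 * v * a * (d * e ^ 2) ^ 2 + 16 * (d * e ^ 2) ^ 3 : ℤ) : ℚ) := by
      push_cast
      rw [← ha]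
      linear_combination 16 * ((d : ℚ) * e ^ 2) ^ 3 * h
    obtain ⟨m, hm⟩ := int_of_sq 1 (Or.inl rfl) _ _ this
    rw [hm] at this
    refine ⟨m, ?_⟩
    rw [Int.cast_one, one_mul] at this
    exact_mod_cast this.symm
  rcases he with he | he
  · have ha : x * (4 * (d * e ^ 2)) = (n : ℤ) := by
      rw [← hxk', he]; push_cast; ring
    obtain ⟨m, hm⟩ := hm n ha
    refine ⟨n, e, m, he0, ha, by rw [he], by rw [he], ?_, hm⟩
    rw [he, show 4 * (d * e ^ 2) = 2 * (2 * (d * e ^ 2)) by ring] at hred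
    exact hred.of_mul_right_right
  · have ha : x * (4 * (d * e ^ 2)) = ((-n : ℤ) : ℚ) := by
      push_cast
      rw [← hxk', he]; push_cast; ring
    obtain ⟨m, hm⟩ := hm (-n) ha
    refine ⟨-n, e, m, he0, ha, by rw [he]; simp, by rw [he]; simp, ?_, hm⟩
    rw [he, show -(4 * (d * e ^ 2)) = 2 * -(2 * (d * e ^ 2)) by ring] at hred
    have := hred.of_mul_right_right
    exact (IsCoprime.neg_left (IsCoprime.neg_right_iff _ _ |>.1 this))

theorem den_facts (A B : ℤ) (hA : Odd A) (hB : Even B) (hB0 : B ≠ 0) :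
    2 ∣ ((A : ℚ) / B).den ∧ (((A : ℚ) / B).den : ℤ) ∣ B := by
  have hdv : (((A : ℚ) / B).den : ℤ) ∣ B := by
    have := Rat.den_dvd A B
    rwa [Rat.divInt_eq_div] at this
  refine ⟨?_, hdv⟩
  have h := Rat.mul_den_eq_num ((A : ℚ) / B)
  have hBq : (B : ℚ) ≠ 0 := by exact_mod_cast hB0
  have h2 : A * (((A : ℚ) / B).den : ℤ) = ((A : ℚ) / B).num * B := by
    have : (A : ℚ) * (((A : ℚ) / B).den : ℤ) = ((A : ℚ) / B).num * B := by
      rw [← h]; push_cast; field_simp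
    exact_mod_cast this
  have h3 : Even (A * (((A : ℚ) / B).den : ℤ)) := by rw [h2]; exact hB.mul_left _
  rcases Int.even_mul.1 h3 with h | h
  · exact absurd h (Int.not_even_iff_odd.2 hA)
  · rw [even_iff_two_dvd] at h
    exact_mod_cast h

theorem no_even_11_aux (d : ℤ) (hd : d = 1 ∨ d = -5) (n : ℕ) : ∀ (x w : ℚ),
    d * w ^ 2 = 4 * x ^ 3 - 4 * x ^ 2 + 1 → 2 ∣ x.den → (4 : ℤ) ^ n ∣ x.den := by
  induction n with
  | zero => intro x w _ _; simp
  | succ n ih =>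
    intro x w h hx
    obtain ⟨a, e, m, he0, ha, h1, h2, hc, hm⟩ := extract (-1) 0 d (by
      rcases hd with h | h
      · exact Or.inl h
      · refine Or.inr ⟨h, fun n k h5 => ?_⟩
        have key : ∀ n k : ZMod 5, 4 * n ^ 3 + 4 * (-1) * n ^ 2 * k + 4 * 0 * n * k ^ 2 + k ^ 3 = 0 →
          n = 0 ∧ k = 0 := by decide
        have h5' := (ZMod.intCast_zmod_eq_zero_iff_dvd _ 5).2 h5
        push_cast at h5'
        obtain ⟨h6, h7⟩ := key n k h5'
        exact ⟨(ZMod.intCast_zmod_eq_zero_iff_dvd _ 5).1 h6, (ZMod.intCast_zmod_eq_zero_iff_dvd _ 5).1 h7⟩)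
      x w (by rw [h]; push_cast; ring) hx
    have hD0 : d * e ^ 2 ≠ 0 := by
      apply mul_ne_zero
      · rcases hd with rfl | rfl <;> norm_num
      · exact pow_ne_zero _ he0
    obtain ⟨D, hD⟩ : ∃ D, D = d * e ^ 2 := ⟨_, rfl⟩
    rw [← hD] at h1 h2 hc hm hD0
    obtain ⟨A, B, C, e0, e1, e2⟩ := desc11 a D m hc (by rw [← hm]; ring)
    have hodd : Odd a := by
      rw [← Int.not_even_iff_odd, even_iff_two_dvd]
      intro h
      have := hc.isUnit_of_dvd' h (Dvd.intro _ rfl)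
      revert this; rw [Int.isUnit_iff]; decide
    have hA : Odd A := by
      have : Odd (A ^ 2) := by
        have h := hodd.add_even (show Even (4 * (B * C) - 4 * C ^ 2) from ⟨2 * (B * C) - 2 * C ^ 2, by ring⟩)
        rw [e0] at h
        convert h using 1; ring
      exact (Int.odd_pow' (by norm_num)).1 this
    have hBC : B ^ 2 = 2 * A * (B - C) := by linarith
    have hB : Even B := by
      have : Even (B ^ 2) := ⟨A * (B - C), by rw [hBC]; ring⟩
      exact (Int.even_pow.1 this).1
    have hA0 : A ≠ 0 := by rintro rfl; revert hA; decide
    have hB0 : B ≠ 0 := by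
      intro hB0
      rw [hB0] at hBC e1 e0
      have hC : C = 0 := by
        have : A * C = 0 := by linarith
        exact (mul_eq_zero.1 this).resolve_left hA0
      rw [hC] at e1
      apply hD0; linarith
    obtain ⟨B1, hB1⟩ := hB
    have hAC : A * C = B * (A - B1) := by
      rw [hB1] at hBC ⊢
      linarith
    obtain ⟨f1, f2⟩ := den_facts A B hA ⟨B1, hB1⟩ hB0
    have hBq : (B : ℚ) ≠ 0 := by exact_mod_cast hB0
    have key : 4 * A ^ 2 * D = 4 * A ^ 3 * B - 4 * A ^ 2 * B ^ 2 + B ^ 4 := by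
      have hB1' : B ^ 2 = 2 * (B * B1) := by rw [hB1]; ring
      have : 2 * (A * C) = 2 * A * B - B ^ 2 := by rw [hAC, hB1']; ring
      have e3 : 2 * (2 * A ^ 2 * D) = 2 * (A ^ 2 * (2 * D)) := by ring
      rw [e1] at e3
      linear_combination e3 + (-4 * A * B + 2 * (A * C) + (2 * A * B - B ^ 2)) * this
    have ih' := ih ((A : ℚ) / B) (2 * A * e / B ^ 2) (by
      have hq : (4 : ℚ) * A ^ 2 * (d * e ^ 2) = 4 * A ^ 3 * B - 4 * A ^ 2 * B ^ 2 + B ^ 4 := by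
        rw [hD] at key
        exact_mod_cast key
      field_simp
      linear_combination hq) f1
    have g1 : (4 : ℤ) ^ n ∣ B := ih'.trans f2
    have hcop : IsCoprime ((4 : ℤ) ^ n) A := by
      have : IsCoprime (2 : ℤ) A := by
        rw [Int.prime_two.coprime_iff_not_dvd, ← even_iff_two_dvd, Int.not_even_iff_odd]; exact hA
      have h4 : IsCoprime (4 : ℤ) A := by
        rw [show (4 : ℤ) = 2 * 2 by norm_num]; exact this.mul_left this
      exact h4.pow_left
    have g2 : (4 : ℤ) ^ n ∣ C := by
      apply hcop.dvd_of_dvd_mul_left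
      rw [hAC]; exact g1.mul_right _
    have g3 : (4 : ℤ) ^ n ∣ D := by
      have : D = B * (A - 2 * C) + C * C := by linarith
      rw [this]
      exact (g1.mul_right _).add (g2.mul_right _)
    refine dvd_trans ?_ h2
    rw [pow_succ, mul_comm]
    exact mul_dvd_mul_left _ g3

theorem no_even_19_aux (d : ℤ) (hd : d = 1 ∨ d = -5) (n : ℕ) : ∀ (x w : ℚ),
    d * w ^ 2 = 4 * x ^ 3 + 4 * x ^ 2 + 4 * x + 1 → 2 ∣ x.den → (4 : ℤ) ^ n ∣ x.den := by
  induction n with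
  | zero => intro x w _ _; simp
  | succ n ih =>
    intro x w h hx
    obtain ⟨a, e, m, he0, ha, h1, h2, hc, hm⟩ := extract 1 1 d (by
      rcases hd with h | h
      · exact Or.inl h
      · refine Or.inr ⟨h, fun n k h5 => ?_⟩
        have key : ∀ n k : ZMod 5, 4 * n ^ 3 + 4 * 1 * n ^ 2 * k + 4 * 1 * n * k ^ 2 + k ^ 3 = 0 →
          n = 0 ∧ k = 0 := by decide
        have h5' := (ZMod.intCast_zmod_eq_zero_iff_dvd _ 5).2 h5
        push_cast at h5'
        obtain ⟨h6, h7⟩ := key n k h5'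
        exact ⟨(ZMod.intCast_zmod_eq_zero_iff_dvd _ 5).1 h6, (ZMod.intCast_zmod_eq_zero_iff_dvd _ 5).1 h7⟩)
      x w (by rw [h]; push_cast; ring) hx
    have hD0 : d * e ^ 2 ≠ 0 := by
      apply mul_ne_zero
      · rcases hd with rfl | rfl <;> norm_num
      · exact pow_ne_zero _ he0
    obtain ⟨D, hD⟩ : ∃ D, D = d * e ^ 2 := ⟨_, rfl⟩
    rw [← hD] at h1 h2 hc hm hD0
    obtain ⟨A, B, C, e0, e1, e2⟩ := desc19 a D m hc (by rw [← hm]; ring)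
    have hodd : Odd a := by
      rw [← Int.not_even_iff_odd, even_iff_two_dvd]
      intro h
      have := hc.isUnit_of_dvd' h (Dvd.intro _ rfl)
      revert this; rw [Int.isUnit_iff]; decide
    have hA : Odd A := by
      have : Odd (A ^ 2) := by
        have h := hodd.add_even (show Even (4 * D - 4 * (B * C)) from ⟨2 * D - 2 * (B * C), by ring⟩)
        convert h using 1; linarith
      exact (Int.odd_pow' (by norm_num)).1 this
    obtain ⟨E, hE⟩ : ∃ E, E = B + 2 * C := ⟨_, rfl⟩
    have hBe : B = E - 2 * C := by linarith
    rw [hBe] at e0 e1 e2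
    have hBC : E ^ 2 = - (2 * A * (E - C)) := by linarith
    have hEe : Even E := by
      have : Even (E ^ 2) := ⟨- (A * (E - C)), by rw [hBC]; ring⟩
      exact (Int.even_pow.1 this).1
    have hA0 : A ≠ 0 := by rintro rfl; revert hA; decide
    have hE0 : E ≠ 0 := by
      intro hE0
      rw [hE0] at hBC e1 e0
      have hC : C = 0 := by
        have : A * C = 0 := by linarith
        exact (mul_eq_zero.1 this).resolve_left hA0
      rw [hC] at e1
      apply hD0; linarith
    obtain ⟨E1, hE1⟩ := hEe
    have hAC : A * C = E * (A + E1) := by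
      rw [hE1] at hBC ⊢
      linarith
    obtain ⟨f1, f2⟩ := den_facts (- (A + E)) E (hA.add_even ⟨E1, hE1⟩).neg ⟨E1, hE1⟩ hE0
    have hEq : (E : ℚ) ≠ 0 := by exact_mod_cast hE0
    have key : 4 * A ^ 2 * D = - 4 * A ^ 3 * E - 8 * A ^ 2 * E ^ 2 - 8 * A * E ^ 3 - 3 * E ^ 4 := by
      have hE1' : E ^ 2 = 2 * (E * E1) := by rw [hE1]; ring
      have : 2 * (A * C) = 2 * A * E + E ^ 2 := by rw [hAC, hE1']; ring
      have e3 : 2 * (2 * A ^ 2 * D) = 2 * (A ^ 2 * (2 * D)) := by ring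
      rw [e1] at e3
      linear_combination e3 + (-4 * A ^ 2 + 4 * A * E - 3 * (2 * (A * C) + (2 * A * E + E ^ 2))) * this
    have ih' := ih (((- (A + E) : ℤ) : ℚ) / E) (2 * A * e / E ^ 2) (by
      have hq : (4 : ℚ) * A ^ 2 * (d * e ^ 2) = - 4 * A ^ 3 * E - 8 * A ^ 2 * E ^ 2 - 8 * A * E ^ 3 - 3 * E ^ 4 := by
        rw [hD] at key
        exact_mod_cast key
      push_cast
      field_simp
      linear_combination hq) f1
    have g1 : (4 : ℤ) ^ n ∣ E := ih'.trans f2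
    have hcop : IsCoprime ((4 : ℤ) ^ n) A := by
      have : IsCoprime (2 : ℤ) A := by
        rw [Int.prime_two.coprime_iff_not_dvd, ← even_iff_two_dvd, Int.not_even_iff_odd]; exact hA
      have h4 : IsCoprime (4 : ℤ) A := by
        rw [show (4 : ℤ) = 2 * 2 by norm_num]; exact this.mul_left this
      exact h4.pow_left
    have g2 : (4 : ℤ) ^ n ∣ C := by
      apply hcop.dvd_of_dvd_mul_left
      rw [hAC]; exact g1.mul_right _
    have g3 : (4 : ℤ) ^ n ∣ D := by
      have : D = E * (A + 2 * C) + C * (- 2 * A - 3 * C) := by linarith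
      rw [this]
      exact (g1.mul_right _).add (g2.mul_right _)
    refine dvd_trans ?_ h2
    rw [pow_succ, mul_comm]
    exact mul_dvd_mul_left _ g3

theorem den_contra (x : ℚ) (h : ∀ n : ℕ, (4 : ℤ) ^ n ∣ x.den) : False := by
  have h1 := h x.den
  have h2 : 4 ^ x.den ∣ x.den := by exact_mod_cast h1
  have h3 := Nat.le_of_dvd x.den_pos h2
  have h4 : x.den < 4 ^ x.den := Nat.lt_pow_self (by norm_num)
  omega

theorem no_even_11 (d : ℤ) (hd : d = 1 ∨ d = -5) (x w : ℚ)
    (h : d * w ^ 2 = 4 * x ^ 3 - 4 * x ^ 2 + 1) : ¬ 2 ∣ x.den :=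
  fun hx => den_contra x fun n => no_even_11_aux d hd n x w h hx

theorem no_even_19 (d : ℤ) (hd : d = 1 ∨ d = -5) (x w : ℚ)
    (h : d * w ^ 2 = 4 * x ^ 3 + 4 * x ^ 2 + 4 * x + 1) : ¬ 2 ∣ x.den :=
  fun hx => den_contra x fun n => no_even_19_aux d hd n x w h hx
end Cub
end

section
namespace Cub

/-- two-integrality -/
def O2 (x : ℚ) : Prop := ¬ 2 ∣ x.den

theorem O2.add {x y : ℚ} (hx : O2 x) (hy : O2 y) : O2 (x + y) := by
  intro h
  rcases (Nat.prime_two.dvd_mul).1 (h.trans (Rat.add_den_dvd x y)) with h | h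
  · exact hx h
  · exact hy h

theorem O2.mul {x y : ℚ} (hx : O2 x) (hy : O2 y) : O2 (x * y) := by
  intro h
  rcases (Nat.prime_two.dvd_mul).1 (h.trans (Rat.mul_den_dvd x y)) with h | h
  · exact hx h
  · exact hy h

theorem O2.int (n : ℤ) : O2 (n : ℚ) := by simp [O2]

theorem O2.neg {x : ℚ} (hx : O2 x) : O2 (-x) := by simpa [O2] using hx

theorem O2.sub {x y : ℚ} (hx : O2 x) (hy : O2 y) : O2 (x - y) := by
  rw [sub_eq_add_neg]; exact hx.add hy.neg

theorem O2.of_sq {x : ℚ} (hx : O2 (x ^ 2)) : O2 x := by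
  intro h
  apply hx
  rw [Rat.den_pow]
  exact h.trans (dvd_pow_self _ (by norm_num))

theorem O2.div {n : ℤ} {k : ℕ} (hk : ¬ 2 ∣ k) : O2 ((n : ℚ) / k) := by
  intro h
  apply hk
  have := Rat.den_dvd n k
  rw [Rat.divInt_eq_div] at this
  have h2 : ((n : ℚ) / k).den ∣ k := by exact_mod_cast this
  exact h.trans h2

theorem O2.half : ¬ O2 (1 / 2) := by
  have : (1 / 2 : ℚ).den = 2 := by norm_num
  simp [O2]

theorem O2.cases {x : ℚ} (hx : O2 x) : ∃ y, O2 y ∧ (x = 2 * y ∨ x = 2 * y + 1) := by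
  have h := Rat.num_div_den x
  rcases Int.even_or_odd' x.num with ⟨m, hm | hm⟩
  · refine ⟨(m : ℚ) / x.den, O2.div hx, Or.inl ?_⟩
    conv_lhs => rw [← h, hm]
    push_cast; ring
  · have ho : Odd (x.den) := by
      rw [← Nat.not_even_iff_odd, even_iff_two_dvd]; exact hx
    obtain ⟨k, hk⟩ := ho
    refine ⟨((m - k : ℤ) : ℚ) / x.den, O2.div hx, Or.inr ?_⟩
    have hd0 : (x.den : ℚ) ≠ 0 := by exact_mod_cast x.den_nz
    have hk' : (x.den : ℚ) = 2 * k + 1 := by exact_mod_cast hk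
    conv_lhs => rw [← h, hm]
    push_cast
    field_simp
    rw [hk']; ring

theorem no_both {w : ℚ} {t y1 : ℚ} (ht : t = 2 * y1) (hy : O2 y1) (ht0 : t ≠ 0)
    (H : ∀ l ε : ℚ, ε ^ 2 = 1 → w = ε + 2 * l * t → O2 l) : False := by
  have h1 := H ((w - 1) / (2 * t)) 1 (by norm_num) (by field_simp; ring)
  have h2 := H ((w + 1) / (2 * t)) (-1) (by norm_num) (by field_simp; ring)
  apply O2.half
  have e : (1 / 2 : ℚ) = ((w + 1) / (2 * t) - (w - 1) / (2 * t)) * y1 := by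
    have hy0 : y1 ≠ 0 := by rintro rfl; apply ht0; rw [ht]; ring
    rw [ht]; field_simp; ring
  rw [e]
  exact (h2.sub h1).mul hy

theorem g11_one (x w : ℚ) (h : w ^ 2 = 4 * x ^ 3 - 4 * x ^ 2 + 1) : x = 0 ∨ x = 1 := by
  have H : ∀ x w : ℚ, w ^ 2 = 4 * x ^ 3 - 4 * x ^ 2 + 1 → O2 x := fun x w h =>
    no_even_11 1 (Or.inl rfl) x w (by push_cast; linarith)
  have hx := H x w h
  by_contra hne
  push Not at hne
  obtain ⟨y, hy, hxy | hxy⟩ := hx.cases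
  · refine no_both (w := w) hxy hy hne.1 ?_
    intro l ε hε hw
    have h1 : l * ε + l ^ 2 * x = x ^ 2 - x := by
      have : (4 * x) * (l * ε + l ^ 2 * x) = (4 * x) * (x ^ 2 - x) := by
        rw [hw] at h
        linear_combination h - hε
      exact mul_left_cancel₀ (by simpa using hne.1) this
    have h3 := H (l ^ 2 + 1 - x) (ε + 2 * l * (l ^ 2 + 1 - x)) (by
      linear_combination hε + 4 * (l ^ 2 + 1 - x) * h1)
    apply O2.of_sq
    have := (h3.add hx).sub (O2.int 1)
    convert this using 1
    push_cast; ring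
  · refine no_both (w := w) (t := x - 1) (y1 := y) (by rw [hxy]; ring) hy (sub_ne_zero.2 hne.2) ?_
    intro l ε hε hw
    have h1 : l * ε + l ^ 2 * (x - 1) = x ^ 2 := by
      have : (4 * (x - 1)) * (l * ε + l ^ 2 * (x - 1)) = (4 * (x - 1)) * (x ^ 2) := by
        rw [hw] at h
        linear_combination h - hε
      exact mul_left_cancel₀ (by simpa using sub_ne_zero.2 hne.2) this
    have h3 := H (l ^ 2 - x) (ε + 2 * l * (l ^ 2 - x - 1)) (by
      linear_combination hε + 4 * (l ^ 2 - x - 1) * h1)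
    apply O2.of_sq
    have := (h3.add hx)
    convert this using 1
    push_cast; ring

/-- reduce a 2-integral point on the curve modulo powers of two -/
theorem int_form (u v d : ℤ) (hd : d = 1 ∨ d = -5) (x w : ℚ)
    (h : d * w ^ 2 = 4 * x ^ 3 + 4 * u * x ^ 2 + 4 * v * x + 1) :
    ∃ r : ℤ, d * r ^ 2 = x.den * (4 * x.num ^ 3 + 4 * u * x.num ^ 2 * x.den + 4 * v * x.num * x.den ^ 2 + x.den ^ 3) := by
  have hxk' : x * (x.den : ℤ) = x.num := by exact_mod_cast Rat.mul_den_eq_num x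
  generalize (x.den : ℤ) = k at *
  generalize x.num = n at *
  have e1 : (d : ℚ) * (k ^ 2 * w) ^ 2 = ((k * (4 * n ^ 3 + 4 * u * n ^ 2 * k + 4 * v * n * k ^ 2 + k ^ 3) : ℤ) : ℚ) := by
    push_cast
    rw [← hxk']
    linear_combination (k : ℚ) ^ 4 * h
  obtain ⟨r, hr⟩ := int_of_sq d hd _ _ e1
  rw [hr] at e1
  exact ⟨r, by exact_mod_cast e1⟩

theorem not_m5 (u v : ℤ) (x w : ℚ) (hx : O2 x)
    (h : ((-5 : ℤ) : ℚ) * w ^ 2 = 4 * x ^ 3 + 4 * u * x ^ 2 + 4 * v * x + 1) : False := by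
  obtain ⟨r, hr⟩ := int_form u v (-5) (Or.inr rfl) x w h
  have hk : Odd (x.den : ℤ) := by
    have : Odd (x.den) := by
      rw [← Nat.not_even_iff_odd, even_iff_two_dvd]; exact hx
    exact_mod_cast this
  obtain ⟨j, hj⟩ := hk
  rw [hj] at hr
  have key : ∀ r j n u v : ZMod 4, (-5) * r ^ 2 ≠ (2 * j + 1) * (4 * n ^ 3 + 4 * u * n ^ 2 * (2 * j + 1)
    + 4 * v * n * (2 * j + 1) ^ 2 + (2 * j + 1) ^ 3) := by
      have e4 : (4 : ZMod 4) = 0 := by decide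
      rw [e4]
      simp only [zero_mul, zero_add]
      decide
  have := congrArg (Int.cast : ℤ → ZMod 4) hr
  push_cast at this
  exact key _ _ _ _ _ this

theorem g11_m5 (x w : ℚ) (h : (-5) * w ^ 2 = 4 * x ^ 3 - 4 * x ^ 2 + 1) : False := by
  refine not_m5 (-1) 0 x w (no_even_11 (-5) (Or.inr rfl) x w (by push_cast; linarith)) ?_
  push_cast; linarith

theorem g19_m5 (x w : ℚ) (h : (-5) * w ^ 2 = 4 * x ^ 3 + 4 * x ^ 2 + 4 * x + 1) : False := by
  refine not_m5 1 1 x w (no_even_19 (-5) (Or.inr rfl) x w (by push_cast; linarith)) ?_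
  push_cast; linarith

theorem g19_one (x w : ℚ) (h : w ^ 2 = 4 * x ^ 3 + 4 * x ^ 2 + 4 * x + 1) : x = 0 := by
  have H : ∀ x w : ℚ, w ^ 2 = 4 * x ^ 3 + 4 * x ^ 2 + 4 * x + 1 → O2 x := fun x w h =>
    no_even_19 1 (Or.inl rfl) x w (by push_cast; linarith)
  have hx := H x w h
  by_contra hne
  obtain ⟨y, hy, hxy | hxy⟩ := hx.cases
  · refine no_both (w := w) hxy hy hne ?_
    intro l ε hε hw
    have h1 : l * ε + l ^ 2 * x = x ^ 2 + x + 1 := by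
      have : (4 * x) * (l * ε + l ^ 2 * x) = (4 * x) * (x ^ 2 + x + 1) := by
        rw [hw] at h
        linear_combination h - hε
      exact mul_left_cancel₀ (by simpa using hne) this
    have h3 := H (l ^ 2 - 1 - x) (ε + 2 * l * (l ^ 2 - 1 - x)) (by
      linear_combination hε + 4 * (l ^ 2 - 1 - x) * h1)
    apply O2.of_sq
    have := (h3.add hx).add (O2.int 1)
    convert this using 1
    push_cast; ring
  · -- both the numerator and the denominator are odd
    obtain ⟨r, hr⟩ := int_form 1 1 1 (Or.inl rfl) x w (by push_cast; linarith)
    have hk : Odd (x.den : ℤ) := by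
      have : Odd (x.den) := by
        rw [← Nat.not_even_iff_odd, even_iff_two_dvd]; exact hx
      exact_mod_cast this
    have hn : Odd x.num := by
      rw [← Int.not_even_iff_odd]
      rintro ⟨m, hm⟩
      have hx' : x / 2 = (m : ℚ) / x.den := by
        conv_lhs => rw [← Rat.num_div_den x, hm]
        push_cast; ring
      have h2 : O2 (x / 2) := by rw [hx']; exact O2.div hx
      apply O2.half
      have : (1 / 2 : ℚ) = x / 2 - y := by rw [hxy]; ring
      rw [this]
      exact h2.sub hy
    obtain ⟨j, hj⟩ := hk
    obtain ⟨i, hi⟩ := hn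
    rw [hj, hi] at hr
    have key : ∀ r j i : ZMod 8, 1 * r ^ 2 ≠ (2 * j + 1) * (4 * (2 * i + 1) ^ 3 + 4 * 1 * (2 * i + 1) ^ 2 * (2 * j + 1)
      + 4 * 1 * (2 * i + 1) * (2 * j + 1) ^ 2 + (2 * j + 1) ^ 3) := by decide
    have := congrArg (Int.cast : ℤ → ZMod 8) hr
    push_cast at this
    exact key _ _ _ this
end Cub
end

section
namespace Cub

/-- A monic integral quartic with no root modulo `2` has no rational root. -/
theorem quartic_ne (a b c d : ℤ) (x : ℚ) (h0 : Odd d) (h1 : Odd (1 + a + b + c + d)) :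
    x ^ 4 + a * x ^ 3 + b * x ^ 2 + c * x + d ≠ 0 := by
  intro h
  have hden : (x.den : ℚ) ≠ 0 := by exact_mod_cast x.den_nz
  have hx : x * x.den = x.num := Rat.mul_den_eq_num x
  have e : ((x.num ^ 4 + a * x.num ^ 3 * x.den + b * x.num ^ 2 * x.den ^ 2 + c * x.num * x.den ^ 3
      + d * x.den ^ 4 : ℤ) : ℚ) = 0 := by
    push_cast
    rw [← hx]
    linear_combination (x.den : ℚ) ^ 4 * h
  have e' : x.num ^ 4 + a * x.num ^ 3 * x.den + b * x.num ^ 2 * x.den ^ 2 + c * x.num * x.den ^ 3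
      + d * x.den ^ 4 = 0 := by exact_mod_cast e
  have hc : ¬ (2 ∣ x.num ∧ (2 : ℤ) ∣ x.den) := by
    rintro ⟨h1, h2⟩
    have h3 : IsCoprime x.num (x.den : ℤ) := by
      rw [Int.isCoprime_iff_gcd_eq_one]; exact x.reduced
    have := h3.isUnit_of_dvd' h1 h2
    rw [Int.isUnit_iff] at this
    omega
  have hc2 : ¬ ((x.num : ZMod 2) = 0 ∧ ((x.den : ℤ) : ZMod 2) = 0) := by
    rw [ZMod.intCast_zmod_eq_zero_iff_dvd x.num 2, ZMod.intCast_zmod_eq_zero_iff_dvd (x.den : ℤ) 2]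
    exact_mod_cast hc
  have e2 := congrArg (Int.cast : ℤ → ZMod 2) e'
  have h0' : (d : ZMod 2) = 1 := by
    obtain ⟨k, rfl⟩ := h0
    push_cast
    rw [show (2 : ZMod 2) = 0 from rfl]; ring
  have h1' : (1 + a + b + c + d : ZMod 2) = 1 := by
    obtain ⟨k, hk⟩ := h1
    have := congrArg (Int.cast : ℤ → ZMod 2) hk
    push_cast at this
    rw [this, show (2 : ZMod 2) = 0 from rfl]; ring
  push_cast at e2 hc2
  revert e2 hc2 h0' h1'
  generalize (x.num : ZMod 2) = n
  generalize (x.den : ZMod 2) = k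
  generalize (a : ZMod 2) = a
  generalize (b : ZMod 2) = b
  generalize (c : ZMod 2) = c
  generalize (d : ZMod 2) = d
  revert n k a b c d
  decide

theorem D11_ne (x : ℚ) : 5 * x ^ 2 + 5 * x - 29 ≠ 0 := by
  intro h
  obtain ⟨r, hr⟩ := int_of_sq 1 (Or.inl rfl) (10 * x + 5) 605 (by push_cast; linarith)
  have : ((r ^ 2 : ℤ) : ℚ) = (605 : ℤ) := by push_cast; rw [← hr]; linarith
  have : r ^ 2 = 605 := by exact_mod_cast this
  have h1 : r < 25 := by nlinarith
  have h2 : -25 < r := by nlinarith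
  interval_cases r <;> omega

/-- The degree 5 isogeny from `X₀(11)` (and its twists). -/
theorem iso11 (d x w : ℚ) (h : d * w ^ 2 = 4 * x ^ 3 - 4 * x ^ 2 - 40 * x - 79) :
    ∃ U V : ℚ, d * V ^ 2 = 4 * U ^ 3 - 4 * U ^ 2 + 1 ∧
      U * (5 * x ^ 2 + 5 * x - 29) ^ 2 = (x - 5) * (x ^ 4 + 15 * x ^ 3 + 120 * x ^ 2 + 200 * x + 155) := by
  have hD := D11_ne x
  refine ⟨(x - 5) * (x ^ 4 + 15 * x ^ 3 + 120 * x ^ 2 + 200 * x + 155) / (5 * x ^ 2 + 5 * x - 29) ^ 2,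
    w * (x ^ 6 + 3 * x ^ 5 - 54 * x ^ 4 + 613 * x ^ 3 + 1752 * x ^ 2 + 8585 * x + 6451) /
      (5 * x ^ 2 + 5 * x - 29) ^ 3, ?_, ?_⟩
  · generalize hDD : 5 * x ^ 2 + 5 * x - 29 = D at hD ⊢
    field_simp
    subst hDD
    linear_combination (x ^ 6 + 3 * x ^ 5 - 54 * x ^ 4 + 613 * x ^ 3 + 1752 * x ^ 2 + 8585 * x + 6451) ^ 2 * h
  · exact div_mul_cancel₀ _ (pow_ne_zero 2 hD)

theorem f11_m5 (x w : ℚ) (h : (-5) * w ^ 2 = 4 * x ^ 3 - 4 * x ^ 2 - 40 * x - 79) : False := by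
  obtain ⟨U, V, h1, -⟩ := iso11 (-5) x w h
  exact g11_m5 U V h1

theorem f11_one (x w : ℚ) (h : w ^ 2 = 4 * x ^ 3 - 4 * x ^ 2 - 40 * x - 79) : x = 5 ∨ x = 16 := by
  obtain ⟨U, V, h1, h2⟩ := iso11 1 x w (by linarith)
  have q1 := quartic_ne 15 120 200 155 x (by decide) (by decide)
  have q2 := quartic_ne 1 11 41 101 x (by decide) (by decide)
  push_cast at q1 q2
  rcases g11_one U V (by linarith) with rfl | rfl
  · left
    have : (x - 5) * (x ^ 4 + 15 * x ^ 3 + 120 * x ^ 2 + 200 * x + 155) = 0 := by linarith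
    rcases mul_eq_zero.1 this with h | h
    · linarith
    · exact absurd h q1
  · right
    have : (x - 16) * (x ^ 4 + 1 * x ^ 3 + 11 * x ^ 2 + 41 * x + 101) = 0 := by linarith
    rcases mul_eq_zero.1 this with h | h
    · linarith
    · exact absurd h q2

/-- The degree 3 isogeny from `X₀(19)` (and its twists). -/
theorem iso19 (d x w : ℚ) (hd : d = 1 ∨ d = -5) (h : d * w ^ 2 = 4 * x ^ 3 + 4 * x ^ 2 - 36 * x - 59) :
    ∃ U V : ℚ, d * V ^ 2 = 4 * U ^ 3 + 4 * U ^ 2 + 4 * U + 1 ∧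
      U * (3 * x + 4) ^ 2 = (x - 5) * (x ^ 2 + 5 * x + 7) := by
  have hD : 3 * x + 4 ≠ 0 := by
    intro h0
    have hx : x = -4 / 3 := by linarith
    subst hx
    rcases hd with rfl | rfl
    · nlinarith [sq_nonneg w]
    · obtain ⟨r, hr⟩ := int_of_sq 1 (Or.inl rfl) (45 * w) 5415 (by push_cast; linarith)
      have : ((r ^ 2 : ℤ) : ℚ) = (5415 : ℤ) := by push_cast; rw [← hr]; linarith
      have : r ^ 2 = 5415 := by exact_mod_cast this
      have h1 : r < 74 := by nlinarith
      have h2 : -74 < r := by nlinarith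
      interval_cases r <;> omega
  refine ⟨(x - 5) * (x ^ 2 + 5 * x + 7) / (3 * x + 4) ^ 2,
    w * (x ^ 3 + 4 * x ^ 2 + 18 * x + 46) / (3 * x + 4) ^ 3, ?_, ?_⟩
  · generalize hDD : 3 * x + 4 = D at hD ⊢
    field_simp
    subst hDD
    linear_combination (x ^ 3 + 4 * x ^ 2 + 18 * x + 46) ^ 2 * h
  · exact div_mul_cancel₀ _ (pow_ne_zero 2 hD)

theorem f19_m5 (x w : ℚ) (h : (-5) * w ^ 2 = 4 * x ^ 3 + 4 * x ^ 2 - 36 * x - 59) : False := by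
  obtain ⟨U, V, h1, -⟩ := iso19 (-5) x w (Or.inr rfl) h
  exact g19_m5 U V h1

theorem f19_one (x w : ℚ) (h : w ^ 2 = 4 * x ^ 3 + 4 * x ^ 2 - 36 * x - 59) : x = 5 := by
  obtain ⟨U, V, h1, h2⟩ := iso19 1 x w (Or.inl rfl) (by linarith)
  have := g19_one U V (by linarith)
  subst this
  have : (x - 5) * (x ^ 2 + 5 * x + 7) = 0 := by linarith
  rcases mul_eq_zero.1 this with h | h
  · linarith
  · nlinarith [sq_nonneg (2 * x + 5)]
end Cub
end

section
namespace Cub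

theorem csq (a b c e : ℤ) (h : IsCoprime a b) (he : e = 1 ∨ e = -1) (hab : a * b = e * c ^ 2)
    (h0 : a * b ≠ 0) :
    ∃ s m n : ℤ, (s = 1 ∨ s = -1) ∧ a = s * m ^ 2 ∧ b = e * s * n ^ 2 := by
  have ha : a ≠ 0 := left_ne_zero_of_mul h0
  have hb : b ≠ 0 := right_ne_zero_of_mul h0
  have key : ∀ a b : ℤ, IsCoprime a b → a * b = e * c ^ 2 → ∃ s m : ℤ, (s = 1 ∨ s = -1) ∧ a = s * m ^ 2 := by
    intro a b h hab
    rcases he with rfl | rfl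
    · obtain ⟨m, hm | hm⟩ := Int.sq_of_isCoprime h (by rw [hab]; ring : a * b = c ^ 2)
      · exact ⟨1, m, Or.inl rfl, by rw [hm]; ring⟩
      · exact ⟨-1, m, Or.inr rfl, by rw [hm]; ring⟩
    · obtain ⟨m, hm | hm⟩ := Int.sq_of_isCoprime h.neg_right (by rw [mul_neg, hab]; ring : a * (-b) = c ^ 2)
      · exact ⟨1, m, Or.inl rfl, by rw [hm]; ring⟩
      · exact ⟨-1, m, Or.inr rfl, by rw [hm]; ring⟩
  obtain ⟨s, m, hs, hm⟩ := key a b h hab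
  obtain ⟨s', n, hs', hn⟩ := key b a h.symm (by rw [mul_comm]; exact hab)
  have hc : c ≠ 0 := by rintro rfl; apply h0; rw [hab]; ring
  have hm0 : m ≠ 0 := by rintro rfl; apply ha; rw [hm]; ring
  have hn0 : n ≠ 0 := by rintro rfl; apply hb; rw [hn]; ring
  have p1 : 0 < c ^ 2 := by positivity
  have p2 : 0 < m ^ 2 * n ^ 2 := by positivity
  have e1 : s * s' * (m ^ 2 * n ^ 2) = e * c ^ 2 := by rw [← hab, hm, hn]; ring
  refine ⟨s, m, n, hs, hm, ?_⟩
  rcases hs with rfl | rfl <;> rcases hs' with rfl | rfl <;> rcases he with rfl | rfl <;>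
    first
    | (rw [hn]; ring; done)
    | (exfalso; linarith)

theorem cop_facts (a b : ℤ) (hc : IsCoprime a b) :
    IsCoprime a (a + b) ∧ IsCoprime b (a + b) ∧ IsCoprime b (a - 16 * b) := by
  obtain ⟨u, v, h⟩ := hc
  exact ⟨⟨u - v, v, by linear_combination h⟩, ⟨v - u, u, by linear_combination h⟩,
    ⟨v + 16 * u, u, by linear_combination h⟩⟩

theorem cop_sub (a b k : ℤ) (hc : IsCoprime a b) (hk : IsCoprime a k) : IsCoprime a (a - k * b) := by
  obtain ⟨u, v, h⟩ := hk.mul_right hc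
  exact ⟨u + v, -v, by linear_combination h⟩

theorem cop_odd (a : ℤ) (ha : a % 2 = 1) (n : ℕ) : IsCoprime a (2 ^ n) := by
  apply IsCoprime.pow_right
  exact ⟨1, -(a / 2), by omega⟩

theorem pos_s {s m x : ℤ} (hs : s = 1 ∨ s = -1) (h : x = s * m ^ 2) (hx : 0 < x) : s = 1 := by
  rcases hs with rfl | rfl
  · rfl
  · nlinarith [sq_nonneg m]

theorem odd_sq8 (x : ℤ) (h : x % 2 = 1) : x ^ 2 % 8 = 1 := by
  obtain ⟨k, rfl⟩ : ∃ k, x = 2 * k + 1 := ⟨x / 2, by omega⟩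
  have : (k * (k + 1)) % 2 = 0 := Int.even_iff.1 (Int.even_mul_succ_self k)
  have e : (2 * k + 1) ^ 2 = 4 * (k * (k + 1)) + 1 := by ring
  omega

theorem cop17 (a b : ℤ) (hc : IsCoprime a b) (h17 : ¬ 17 ∣ a + b) : IsCoprime (a + b) (a - 16 * b) := by
  have h := (cop_facts a b hc).2.1.symm
  have p : IsCoprime (a + b) 17 := by
    have : Prime (17 : ℤ) := by norm_num
    exact ((Prime.coprime_iff_not_dvd this).2 h17).symm
  have := cop_sub (a + b) b 17 h p
  convert this using 1; ring

theorem sq_odd_iff (x : ℤ) : x ^ 2 % 2 = x % 2 := by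
  rcases Int.emod_two_eq_zero_or_one x with h | h <;> simp [pow_two, Int.mul_emod, h]

theorem core1 (a b r : ℤ) (ha : 0 < a) (hb : 0 < b) (hc : IsCoprime a b) (h17 : ¬ 17 ∣ a + b)
    (h : a * b * (a + b) * (a - 16 * b) = r ^ 2) (hne : a - 16 * b ≠ 0) :
    ∃ α β ζ δ : ℤ, a = α ^ 2 ∧ b = β ^ 2 ∧ a + b = ζ ^ 2 ∧ a - 16 * b = δ ^ 2 := by
  obtain ⟨c1, c2, c3⟩ := cop_facts a b hc
  have c4 := cop17 a b hc h17
  have hab : 0 < a + b := by omega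
  have hpos : 0 < a - 16 * b := by
    have : 0 ≤ a * b * (a + b) * (a - 16 * b) := by rw [h]; positivity
    have := nonneg_of_mul_nonneg_right this (by positivity)
    omega
  obtain ⟨s, β, n, hs, hβ, hn⟩ := csq b (a * (a + b) * (a - 16 * b)) r 1
    ((hc.symm.mul_right c2).mul_right c3) (Or.inl rfl) (by linarith) (by positivity)
  have := pos_s hs hβ hb
  subst this
  obtain ⟨s, ζ, n', hs, hζ, hn'⟩ := csq (a + b) (a * (a - 16 * b)) n 1
    (c1.symm.mul_right c4) (Or.inl rfl) (by linarith) (by positivity)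
  have := pos_s hs hζ hab
  subst this
  rcases Int.emod_two_eq_zero_or_one a with ha2 | ha2
  · -- `a` even
    have hb2 : b % 2 = 1 := by
      by_contra hb2
      have := hc.isUnit_of_dvd' (show (2 : ℤ) ∣ a by omega) (show (2 : ℤ) ∣ b by omega)
      rw [Int.isUnit_iff] at this; omega
    have hβ8 := odd_sq8 β (by rw [← sq_odd_iff]; omega)
    have hζ8 := odd_sq8 ζ (by rw [← sq_odd_iff]; omega)
    obtain ⟨m, hm⟩ : ∃ m, a = 8 * m := ⟨a / 8, by omega⟩
    have hcm : IsCoprime m b := by rw [hm] at hc; exact hc.of_mul_left_right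
    have hmn : m * (m - 2 * b) * 64 = n' ^ 2 := by rw [hm] at hn'; linarith
    obtain ⟨k, hk⟩ : (8 : ℤ) ∣ n' := by
      rw [← Int.pow_dvd_pow_iff (n := 2) (by norm_num), ← hmn]
      exact ⟨m * (m - 2 * b), by ring⟩
    have hk2 : m * (m - 2 * b) = k ^ 2 := by rw [hk] at hmn; linarith
    have hmpos : 0 < m := by omega
    have hmpos2 : 0 < m - 2 * b := by omega
    rcases Int.emod_two_eq_zero_or_one m with hm2 | hm2
    · obtain ⟨l, hl⟩ : ∃ l, m = 2 * l := ⟨m / 2, by omega⟩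
      have hcl : IsCoprime l b := by rw [hl] at hcm; exact hcm.of_mul_left_right
      have hmn : l * (l - 1 * b) * 4 = k ^ 2 := by rw [hl] at hk2; linarith
      obtain ⟨k', hk'⟩ : (2 : ℤ) ∣ k := by
        rw [← Int.pow_dvd_pow_iff (n := 2) (by norm_num), ← hmn]
        exact ⟨l * (l - 1 * b), by ring⟩
      have hk3 : l * (l - 1 * b) = k' ^ 2 := by rw [hk'] at hmn; linarith
      have hl1 : 0 < l := by omega
      have hl2 : 0 < l - 1 * b := by omega
      obtain ⟨s, κ, μ, hs, hκ, hμ⟩ := csq l (l - 1 * b) k' 1 (cop_sub l b 1 hcl isCoprime_one_right)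
        (Or.inl rfl) (by linarith) (by positivity)
      have := pos_s hs hκ hl1
      subst this
      exact ⟨4 * κ, β, ζ, 4 * μ, by linarith, by linarith, by linarith, by linarith⟩
    · exfalso
      obtain ⟨s, κ, μ, hs, hκ, hμ⟩ := csq m (m - 2 * b) k 1
        (cop_sub m b 2 hcm (by simpa using cop_odd m hm2 1))
        (Or.inl rfl) (by linarith) (by positivity)
      have := pos_s hs hκ hmpos
      subst this
      have h1 := odd_sq8 κ (by rw [← sq_odd_iff]; omega)
      have h2 := odd_sq8 μ (by rw [← sq_odd_iff]; omega)
      omega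
  · obtain ⟨s, α, δ, hs, hα, hδ⟩ := csq a (a - 16 * b) n' 1
        (cop_sub a b 16 hc (by simpa using cop_odd a ha2 4))
        (Or.inl rfl) (by linarith) (by positivity)
    have := pos_s hs hα ha
    subst this
    exact ⟨α, β, ζ, δ, by linarith, by linarith, by linarith, by linarith⟩
end Cub
end

section
namespace Cub

theorem sign_mul {s t : ℤ} (hs : s = 1 ∨ s = -1) (ht : t = 1 ∨ t = -1) : s * t = 1 ∨ s * t = -1 := by
  rcases hs with rfl | rfl <;> rcases ht with rfl | rfl <;> simp

theorem sign_cast {s : ℤ} (hs : s = 1 ∨ s = -1) : (s : ZMod 5) = 1 ∨ (s : ZMod 5) = -1 := by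
  rcases hs with rfl | rfl <;> simp

theorem core5_even (α β ζ δ : ℤ) (hc : IsCoprime (α ^ 2) (5 * β ^ 2)) (h1 : α ^ 2 + 5 * β ^ 2 = ζ ^ 2)
    (h2 : α ^ 2 - 16 * (5 * β ^ 2) = - δ ^ 2) : False := by
  have key : ∀ x y n : ℤ, x ^ 2 + y ^ 2 = 4 * n → x % 2 = 0 ∧ y % 2 = 0 := by
    intro x y n h
    rcases Int.emod_two_eq_zero_or_one x with hx | hx <;>
    rcases Int.emod_two_eq_zero_or_one y with hy | hy
    · exact ⟨hx, hy⟩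
    · have := odd_sq8 y hy; have := sq_odd_iff x; omega
    · have := odd_sq8 x hx; have := sq_odd_iff y; omega
    · have := odd_sq8 y hy; have := odd_sq8 x hx; omega
  obtain ⟨h3, h4⟩ := key α δ (20 * β ^ 2) (by linarith)
  obtain ⟨x, hx⟩ : ∃ x, α = 2 * x := ⟨α / 2, by omega⟩
  obtain ⟨y, hy⟩ : ∃ y, δ = 2 * y := ⟨δ / 2, by omega⟩
  subst hx hy
  obtain ⟨h5, h6⟩ := key x y (5 * β ^ 2) (by linarith)
  obtain ⟨x', hx⟩ : ∃ x', x = 2 * x' := ⟨x / 2, by omega⟩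
  subst hx
  have hb : β % 2 = 1 := by
    by_contra hb
    have := hc.isUnit_of_dvd' (show (2 : ℤ) ∣ (2 * (2 * x')) ^ 2 from ⟨8 * x' ^ 2, by ring⟩)
      (show (2 : ℤ) ∣ 5 * β ^ 2 from ((show (2 : ℤ) ∣ β by omega).pow two_ne_zero).mul_left 5)
    rw [Int.isUnit_iff] at this; omega
  have h7 := odd_sq8 β hb
  have h8 : ζ ^ 2 = 16 * x' ^ 2 + 5 * β ^ 2 := by linarith
  have h9 := sq_odd_iff ζ
  have h10 := odd_sq8 ζ (by omega)
  omega

theorem core5 (a b r : ℤ) (hb : 0 < b) (hc : IsCoprime a b) (h5 : 5 ∣ b)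
    (h : a * b * (a + b) * (a - 16 * b) = -5 * r ^ 2) (ha : a ≠ 0) (hab : a + b ≠ 0)
    (hne : a - 16 * b ≠ 0) :
    ∃ α β ζ δ : ℤ, a = - α ^ 2 ∧ b = 5 * β ^ 2 ∧ a + b = - ζ ^ 2 ∧ a - 16 * b = - δ ^ 2 := by
  obtain ⟨c1, c2, c3⟩ := cop_facts a b hc
  obtain ⟨b', hb'⟩ := h5
  have hb0 : b ≠ 0 := hb.ne'
  have hb'0 : b' ≠ 0 := by rintro rfl; simp at hb'; omega
  have ha5 : (a : ZMod 5) ≠ 0 := by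
    intro h0
    rw [ZMod.intCast_zmod_eq_zero_iff_dvd a 5] at h0
    have := hc.isUnit_of_dvd' h0 (show ((5 : ℕ) : ℤ) ∣ b from ⟨b', hb'⟩)
    rw [Int.isUnit_iff] at this; omega
  have hbz : (b : ZMod 5) = 0 := by
    rw [ZMod.intCast_zmod_eq_zero_iff_dvd b 5]; exact ⟨b', hb'⟩
  have cb : IsCoprime b' (a * (a + b) * (a - 16 * b)) := by
    have := (hc.symm.mul_right c2).mul_right c3
    nth_rewrite 1 [hb'] at this
    exact this.of_mul_left_right
  obtain ⟨s, β, n, hs, hβ, hn⟩ := csq b' (a * (a + b) * (a - 16 * b)) r (-1) cb (Or.inr rfl)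
    (by
      have : 5 * (b' * (a * (a + b) * (a - 16 * b))) = 5 * (-1 * r ^ 2) := by
        rw [show 5 * (b' * (a * (a + b) * (a - 16 * b))) = a * (5 * b') * (a + b) * (a - 16 * b) by ring, ← hb', h]
        ring
      linarith) (by positivity)
  have := pos_s hs hβ (by omega)
  subst this
  have hbβ : b = 5 * β ^ 2 := by rw [hb', hβ]; ring
  by_cases h17 : 17 ∣ a + b
  · exfalso
    obtain ⟨u, hu⟩ := h17
    have hu0 : u ≠ 0 := by rintro rfl; simp at hu; exact hab hu
    have hub : IsCoprime u b := by rw [hu] at c2; exact c2.symm.of_mul_left_right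
    have hua : IsCoprime u a := by rw [hu] at c1; exact c1.symm.of_mul_left_right
    have hm : a - 16 * b = 17 * (u - 1 * b) := by linarith
    have hm0 : u - 1 * b ≠ 0 := by intro h; rw [h] at hm; simp at hm; exact hne hm
    have e1 : u * (a * (u - 1 * b)) * 17 ^ 2 = - n ^ 2 := by rw [hu, hm] at hn; linarith
    obtain ⟨k, hk⟩ : (17 : ℤ) ∣ n := by
      rw [← Int.pow_dvd_pow_iff (n := 2) (by norm_num)]
      exact ⟨- (u * (a * (u - 1 * b))), by linarith⟩
    obtain ⟨s, m, l, hs, hm', hl⟩ := csq u (a * (u - 1 * b)) k (-1)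
      (hua.mul_right (cop_sub u b 1 hub isCoprime_one_right)) (Or.inr rfl) (by rw [hk] at e1; linarith)
      (by positivity)
    have key : ∀ a m l s : ZMod 5, a ≠ 0 → (s = 1 ∨ s = -1) → a = 17 * (s * m ^ 2) →
      a * (s * m ^ 2) = -1 * s * l ^ 2 → False := by decide
    have f1 := congrArg (Int.cast : ℤ → ZMod 5) hu
    have f2 := congrArg (Int.cast : ℤ → ZMod 5) hl
    have f3 := congrArg (Int.cast : ℤ → ZMod 5) hm'
    push_cast at f1 f2 f3
    rw [hbz, f3] at f1 f2
    exact key a m l s ha5 (sign_cast hs) (by linear_combination f1) (by linear_combination f2)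
  · have c4 := cop17 a b hc h17
    obtain ⟨s, ζ, n', hs, hζ, hn'⟩ := csq (a + b) (a * (a - 16 * b)) n (-1)
      (c1.symm.mul_right c4) (Or.inr rfl) (by linarith) (by positivity)
    have main : ∃ s' α δ : ℤ, (s' = 1 ∨ s' = -1) ∧ a = s' * α ^ 2 ∧ a - 16 * b = - s * s' * δ ^ 2 := by
      rcases Int.emod_two_eq_zero_or_one a with ha2 | ha2
      · have hb2 : b % 2 = 1 := by
          by_contra hb2
          have := hc.isUnit_of_dvd' (show (2 : ℤ) ∣ a by omega) (show (2 : ℤ) ∣ b by omega)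
          rw [Int.isUnit_iff] at this; omega
        have hβ8 := odd_sq8 β (by rw [← sq_odd_iff]; omega)
        have hζ8 := odd_sq8 ζ (by rw [← sq_odd_iff]; rcases hs with rfl | rfl <;> omega)
        rcases hs with rfl | rfl
        · obtain ⟨m, hm⟩ : ∃ m, a = 4 * m := ⟨a / 4, by omega⟩
          have hm2 : m % 2 = 1 := by omega
          have hcm : IsCoprime m b := by rw [hm] at hc; exact hc.of_mul_left_right
          have e1 : m * (m - 4 * b) * 16 = - n' ^ 2 := by rw [hm] at hn'; linarith
          obtain ⟨k, hk⟩ : (4 : ℤ) ∣ n' := by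
            rw [← Int.pow_dvd_pow_iff (n := 2) (by norm_num)]
            exact ⟨- (m * (m - 4 * b)), by linarith⟩
          have : m - 4 * b ≠ 0 := by omega
          have : m ≠ 0 := by omega
          obtain ⟨s', x, y, hs', hx, hy⟩ := csq m (m - 4 * b) k (-1)
            (cop_sub m b 4 hcm (by simpa using cop_odd m hm2 2)) (Or.inr rfl) (by rw [hk] at e1; linarith)
            (by positivity)
          exact ⟨s', 2 * x, 2 * y, hs', by rw [hm]; nth_rewrite 1 [hx]; ring,
            by rw [show a - 16 * b = 4 * (m - 4 * b) by rw [hm]; ring, hy]; ring⟩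
        · exfalso
          obtain ⟨m, hm⟩ : ∃ m, a = 2 * m := ⟨a / 2, by omega⟩
          have hm2 : m % 2 = 1 := by omega
          have hcm : IsCoprime m b := by rw [hm] at hc; exact hc.of_mul_left_right
          have e1 : m * (m - 8 * b) * 4 = n' ^ 2 := by rw [hm] at hn'; linarith
          obtain ⟨k, hk⟩ : (2 : ℤ) ∣ n' := by
            rw [← Int.pow_dvd_pow_iff (n := 2) (by norm_num)]
            exact ⟨(m * (m - 8 * b)), by linarith⟩
          have : m - 8 * b ≠ 0 := by omega
          have : m ≠ 0 := by omega
          obtain ⟨s', x, y, hs', hx, hy⟩ := csq m (m - 8 * b) k 1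
            (cop_sub m b 8 hcm (by simpa using cop_odd m hm2 3)) (Or.inl rfl) (by rw [hk] at e1; linarith)
            (by positivity)
          have key : ∀ a x s z : ZMod 5, a ≠ 0 → (s = 1 ∨ s = -1) → a = 2 * (s * x ^ 2) →
            a = -1 * z ^ 2 → False := by decide
          have f1 := congrArg (Int.cast : ℤ → ZMod 5) hζ
          have f2 := congrArg (Int.cast : ℤ → ZMod 5) hm
          have f3 := congrArg (Int.cast : ℤ → ZMod 5) hx
          push_cast at f1 f2 f3
          rw [hbz] at f1
          rw [f3] at f2
          exact key a x s' ζ ha5 (sign_cast hs') f2 (by linear_combination f1)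
      · obtain ⟨s', α, δ, hs', hα, hδ⟩ := csq a (a - 16 * b) n' (-1 * s)
          (cop_sub a b 16 hc (by simpa using cop_odd a ha2 4))
          (sign_mul (Or.inr rfl) hs) hn' (by positivity)
        exact ⟨s', α, δ, hs', hα, by rw [hδ]; ring⟩
    obtain ⟨s', α, δ, hs', hα, hδ⟩ := main
    have a2 : 0 < α ^ 2 := by
      have : α ≠ 0 := by rintro rfl; apply ha; rw [hα]; ring
      positivity
    have a3 : 0 ≤ ζ ^ 2 := sq_nonneg _
    have a4 : 0 ≤ δ ^ 2 := sq_nonneg _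
    rcases hs' with rfl | rfl
    · have : s = 1 := pos_s hs hζ (by linarith)
      subst this
      exfalso
      rw [hα, hbβ] at hc hζ hδ
      exact core5_even α β ζ δ (by simpa using hc) (by linarith) (by linarith)
    · rcases hs with rfl | rfl
      · exfalso; linarith
      · exact ⟨α, β, ζ, δ, by linarith, hbβ, by linarith, by linarith⟩
end Cub
end

section
namespace Cub

/-- Points of the (twisted) curve `d Y² = t (t+1) (t-16)` that are doubles: `t = α² / (d β²)`. -/
def IsD (d α β ζ δ : ℤ) : Prop :=
  IsCoprime α β ∧ β ≠ 0 ∧ α ^ 2 + d * β ^ 2 = ζ ^ 2 ∧ α ^ 2 - 16 * d * β ^ 2 = δ ^ 2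

/-- `t` and `τ` have the same double. -/
def SameDbl (t τ : ℚ) : Prop :=
  (τ ^ 2 + 16) ^ 2 * (t * (t + 1) * (t - 16)) = (t ^ 2 + 16) ^ 2 * (τ * (τ + 1) * (τ - 16))

theorem SameDbl.trans {a b c : ℚ} (h1 : SameDbl a b) (h2 : SameDbl b c)
    (hb : b * (b + 1) * (b - 16) ≠ 0) : SameDbl a c := by
  unfold SameDbl at *
  have hb2 : (b ^ 2 + 16) ^ 2 ≠ 0 := by positivity
  apply mul_left_cancel₀ hb2
  linear_combination (c ^ 2 + 16) ^ 2 * h1 + (a ^ 2 + 16) ^ 2 * h2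

theorem int_pt (d : ℤ) (hd : d = 1 ∨ d = -5) (t Y : ℚ) (h : t * (t + 1) * (t - 16) = d * Y ^ 2) :
    ∃ r : ℤ, t.num * t.den * (t.num + t.den) * (t.num - 16 * t.den) = d * r ^ 2 := by
  have hx : t * t.den = t.num := Rat.mul_den_eq_num t
  have e : (d : ℚ) * (Y * t.den ^ 2) ^ 2
      = ((t.num * t.den * (t.num + t.den) * (t.num - 16 * t.den) : ℤ) : ℚ) := by
    push_cast
    rw [← hx]
    linear_combination (-(t.den : ℚ) ^ 4) * h
  obtain ⟨r, hr⟩ := int_of_sq d hd _ _ e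
  refine ⟨r, ?_⟩
  rw [hr] at e
  exact_mod_cast e.symm

theorem rat_cop (t : ℚ) : IsCoprime t.num (t.den : ℤ) := by
  rw [Int.isCoprime_iff_gcd_eq_one]; exact t.reduced

theorem ne_facts (t : ℚ) (h0 : t ≠ 0) (h1 : t ≠ -1) (h2 : t ≠ 16) :
    t.num ≠ 0 ∧ t.num + t.den ≠ 0 ∧ t.num - 16 * t.den ≠ 0 := by
  have hx : t * t.den = t.num := Rat.mul_den_eq_num t
  have hden : (t.den : ℚ) ≠ 0 := by exact_mod_cast t.den_nz
  refine ⟨by simpa using h0, fun h => h1 ?_, fun h => h2 ?_⟩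
  · have : (t.num : ℚ) + t.den = 0 := by exact_mod_cast h
    apply mul_right_cancel₀ hden; linarith
  · have : (t.num : ℚ) - 16 * t.den = 0 := by exact_mod_cast h
    apply mul_right_cancel₀ hden; linarith

theorem sq_cop {α β : ℤ} (h : IsCoprime (α ^ 2) (β ^ 2)) : IsCoprime α β :=
  (IsCoprime.pow_iff two_pos two_pos).1 h

theorem Q1 (t Y : ℚ) (h : t * (t + 1) * (t - 16) = Y ^ 2) (ht : 0 < t) (h17 : ¬ (17 : ℤ) ∣ t.num + t.den)
    (h2 : t ≠ 16) : ∃ α β ζ δ : ℤ, IsD 1 α β ζ δ ∧ (α : ℚ) ^ 2 / (1 * β ^ 2) = t := by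
  obtain ⟨r, hr⟩ := int_pt 1 (Or.inl rfl) t Y (by push_cast; linarith)
  obtain ⟨n1, n2, n3⟩ := ne_facts t ht.ne' (by linarith) h2
  obtain ⟨α, β, ζ, δ, e1, e2, e3, e4⟩ := core1 t.num t.den r (Rat.num_pos.2 ht)
    (by exact_mod_cast t.den_pos) (rat_cop t) h17 (by linarith) n3
  refine ⟨α, β, ζ, δ, ⟨?_, ?_, ?_, ?_⟩, ?_⟩
  · apply sq_cop; rw [← e1, ← e2]; exact rat_cop t
  · rintro rfl; have := t.den_pos; zify at this; rw [e2] at this; simp at this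
  · rw [← e1, ← e3, e2]; ring
  · rw [← e1, ← e4, e2]; ring
  · conv_rhs => rw [← Rat.num_div_den t]
    rw [one_mul]
    congr 1
    · exact_mod_cast e1.symm
    · exact_mod_cast e2.symm

theorem Q5 (t Y : ℚ) (h : t * (t + 1) * (t - 16) = (-5) * Y ^ 2) (h5 : (5 : ℤ) ∣ t.den)
    (h0 : t ≠ 0) (h1 : t ≠ -1)
    (h2 : t ≠ 16) : ∃ α β ζ δ : ℤ, IsD (-5) α β ζ δ ∧ (α : ℚ) ^ 2 / ((-5) * β ^ 2) = t := by
  obtain ⟨r, hr⟩ := int_pt (-5) (Or.inr rfl) t Y (by push_cast; linarith)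
  obtain ⟨n1, n2, n3⟩ := ne_facts t h0 h1 h2
  obtain ⟨α, β, ζ, δ, e1, e2, e3, e4⟩ := core5 t.num t.den r
    (by exact_mod_cast t.den_pos) (rat_cop t) h5 (by linarith) n1 n2 n3
  refine ⟨α, β, ζ, δ, ⟨?_, ?_, ?_, ?_⟩, ?_⟩
  · apply sq_cop
    have := rat_cop t
    rw [e1, e2] at this
    exact (IsCoprime.neg_left_iff _ _).1 this.of_mul_right_right
  · rintro rfl; have := t.den_pos; zify at this; rw [e2] at this; simp at this
  · linarith
  · linarith
  · conv_rhs => rw [← Rat.num_div_den t]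
    have e1' : (t.num : ℚ) = - (α : ℚ) ^ 2 := by exact_mod_cast e1
    have e2' : (t.den : ℚ) = 5 * (β : ℚ) ^ 2 := by exact_mod_cast e2
    rw [e1', e2', neg_mul, div_neg, neg_div]

/-- The translations by the 2-torsion points. -/
theorem tr0 (d t Y : ℚ) (h : t * (t + 1) * (t - 16) = d * Y ^ 2) (h0 : t ≠ 0) (h1 : t ≠ -1) (h2 : t ≠ 16) :
    (∃ Y' : ℚ, (-16 / t) * (-16 / t + 1) * (-16 / t - 16) = d * Y' ^ 2) ∧ -16 / t ≠ 0 ∧ -16 / t ≠ -1 ∧ -16 / t ≠ 16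
      ∧ SameDbl t (-16 / t) := by
  refine ⟨⟨16 * Y / t ^ 2, ?_⟩, ?_, ?_, ?_, ?_⟩
  · field_simp
    linear_combination h
  · simp [h0]
  · intro h; field_simp at h; apply h2; linarith
  · intro h; field_simp at h; apply h1; linarith
  · unfold SameDbl; field_simp; ring

theorem tr1 (d t Y : ℚ) (h : t * (t + 1) * (t - 16) = d * Y ^ 2) (h0 : t ≠ 0) (h1 : t ≠ -1) (h2 : t ≠ 16) :
    (∃ Y' : ℚ, ((16 - t) / (t + 1)) * ((16 - t) / (t + 1) + 1) * ((16 - t) / (t + 1) - 16) = d * Y' ^ 2)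
      ∧ (16 - t) / (t + 1) ≠ 0 ∧ (16 - t) / (t + 1) ≠ -1 ∧ (16 - t) / (t + 1) ≠ 16
      ∧ SameDbl t ((16 - t) / (t + 1)) := by
  obtain ⟨u, hu⟩ : ∃ u, u = t + 1 := ⟨_, rfl⟩
  have hu0 : u ≠ 0 := by intro h; apply h1; linarith
  obtain rfl : t = u - 1 := by linarith
  rw [show u - 1 + 1 = u by ring] at *
  refine ⟨⟨17 * Y / u ^ 2, ?_⟩, ?_, ?_, ?_, ?_⟩
  · field_simp
    linear_combination 289 * h
  · rw [div_ne_zero_iff]; exact ⟨fun h => h2 (by linarith), hu0⟩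
  · intro h; field_simp at h; linarith
  · intro h; field_simp at h; apply h0; linarith
  · unfold SameDbl; field_simp; ring

theorem tr2 (d t Y : ℚ) (h : t * (t + 1) * (t - 16) = d * Y ^ 2) (h0 : t ≠ 0) (h1 : t ≠ -1) (h2 : t ≠ 16) :
    (∃ Y' : ℚ, (16 * (t + 1) / (t - 16)) * (16 * (t + 1) / (t - 16) + 1) * (16 * (t + 1) / (t - 16) - 16) = d * Y' ^ 2)
      ∧ 16 * (t + 1) / (t - 16) ≠ 0 ∧ 16 * (t + 1) / (t - 16) ≠ -1 ∧ 16 * (t + 1) / (t - 16) ≠ 16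
      ∧ SameDbl t (16 * (t + 1) / (t - 16)) := by
  obtain ⟨u, hu⟩ : ∃ u, u = t - 16 := ⟨_, rfl⟩
  have hu0 : u ≠ 0 := by intro h; apply h2; linarith
  obtain rfl : t = u + 16 := by linarith
  rw [show u + 16 - 16 = u by ring] at *
  refine ⟨⟨16 * 17 * Y / u ^ 2, ?_⟩, ?_, ?_, ?_, ?_⟩
  · field_simp
    linear_combination 289 * h
  · rw [div_ne_zero_iff]; exact ⟨fun h => h1 (by linarith), hu0⟩
  · intro h; field_simp at h; apply h0; linarith
  · intro h; field_simp at h; linarith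
  · unfold SameDbl; field_simp; ring

/-- comparing numerators and denominators -/
theorem cross (t : ℚ) (m n : ℤ) (hn : n ≠ 0) (h : t = m / n) : t.num * n = m * t.den := by
  have hx : t * t.den = t.num := Rat.mul_den_eq_num t
  have hn' : (n : ℚ) ≠ 0 := by exact_mod_cast hn
  have : t * n = m := by rw [h]; field_simp
  have e : (t.num : ℚ) * n = m * t.den := by rw [← hx, ← this]; ring
  exact_mod_cast e

theorem not_both (t : ℚ) (p : ℤ) (hp : Prime p) (h1 : p ∣ t.num) (h2 : p ∣ t.den) : False :=
  hp.not_isUnit ((rat_cop t).isUnit_of_dvd' h1 h2)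

theorem sel1 (t Y : ℚ) (h : t * (t + 1) * (t - 16) = (1 : ℤ) * Y ^ 2) (h0 : t ≠ 0) (h1 : t ≠ -1) (h2 : t ≠ 16) :
    ∃ α β ζ δ : ℤ, IsD 1 α β ζ δ ∧ SameDbl t ((α : ℚ) ^ 2 / (((1 : ℤ) : ℚ) * β ^ 2)) := by
  have p17 : Prime (17 : ℤ) := by norm_num
  -- the sign
  have stepA : ∀ t Y : ℚ, t * (t + 1) * (t - 16) = (1 : ℤ) * Y ^ 2 → t ≠ 0 → t ≠ -1 → t ≠ 16 →
      ¬ (17 : ℤ) ∣ t.num + t.den →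
      ∃ α β ζ δ : ℤ, IsD 1 α β ζ δ ∧ SameDbl t ((α : ℚ) ^ 2 / (((1 : ℤ) : ℚ) * β ^ 2)) := by
    intro t Y h h0 h1 h2 h17
    rcases lt_or_gt_of_ne h0 with hneg | hpos
    · obtain ⟨⟨Y', hY'⟩, k0, k1, k2, k3⟩ := tr0 _ t Y h h0 h1 h2
      have hc := cross (-16 / t) (-16 * t.den) t.num (by simpa using h0) (by
        conv_lhs => rw [← Rat.num_div_den t]
        push_cast
        rw [div_div_eq_mul_div])
      obtain ⟨α, β, ζ, δ, hD, e⟩ := Q1 (-16 / t) Y' (by rw [hY']; push_cast; ring)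
        (div_pos_of_neg_of_neg (by norm_num) hneg) (by
          intro hd
          have e1 : (17 : ℤ) ∣ (-16 / t).den * (t.num + t.den) := by
            have : ((-16 / t).den : ℤ) * (t.num + t.den) =
              ((-16 / t).num + (-16 / t).den) * t.num + 17 * (t.den * (-16 / t).den) := by linear_combination -hc
            rw [this]
            exact dvd_add (hd.mul_right _) (dvd_mul_right _ _)
          rcases p17.dvd_or_dvd e1 with h | h
          · exact not_both _ _ p17 ((dvd_add_left h).1 hd) h
          · exact h17 h) k2
      refine ⟨α, β, ζ, δ, hD, ?_⟩
      rw [Int.cast_one, e]; exact k3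
    · obtain ⟨α, β, ζ, δ, hD, e⟩ := Q1 t Y (by rw [h]; push_cast; ring) hpos h17 h2
      refine ⟨α, β, ζ, δ, hD, ?_⟩
      rw [Int.cast_one, e]; rfl
  by_cases h17 : (17 : ℤ) ∣ t.num + t.den
  · obtain ⟨⟨Y', hY'⟩, k0, k1, k2, k3⟩ := tr2 _ t Y h h0 h1 h2
    obtain ⟨n1, n2, n3⟩ := ne_facts t h0 h1 h2
    obtain ⟨u, hu⟩ := h17
    have hx : t * t.den = t.num := Rat.mul_den_eq_num t
    have hub : u - t.den ≠ 0 := by omega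
    have ht16 : t - 16 ≠ 0 := sub_ne_zero.2 h2
    have hc := cross (16 * (t + 1) / (t - 16)) (16 * u) (u - t.den) hub (by
      have hu' : (t.num : ℚ) + t.den = 17 * u := by exact_mod_cast hu
      have hub' : (u : ℚ) - t.den ≠ 0 := by exact_mod_cast hub
      push_cast
      rw [div_eq_div_iff ht16 hub']
      have : (u : ℚ) = (t + 1) * t.den / 17 := by rw [← hx] at hu'; linarith
      rw [this]; ring)
    obtain ⟨α, β, ζ, δ, hD, e⟩ := stepA _ Y' hY' k0 k1 k2 (by
      generalize 16 * (t + 1) / (t - 16) = τ at *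
      intro hd
      have e1 : (17 : ℤ) ∣ τ.den * t.den := by
        have : (τ.den * t.den : ℤ) = (τ.num + τ.den) * (t.den - u) + 17 * (u * τ.den) := by
          linear_combination hc
        rw [this]
        exact dvd_add (hd.mul_right _) (dvd_mul_right _ _)
      rcases p17.dvd_or_dvd e1 with h | h
      · exact not_both _ _ p17 ((dvd_add_left h).1 hd) h
      · exact not_both t _ p17 ((dvd_add_left h).1 ⟨u, hu⟩) h)
    refine ⟨α, β, ζ, δ, hD, k3.trans e ?_⟩
    exact mul_ne_zero (mul_ne_zero k0 (fun h => k1 (by linarith))) (fun h => k2 (by linarith))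
  · exact stepA t Y h h0 h1 h2 h17

theorem sel5 (t Y : ℚ) (h : t * (t + 1) * (t - 16) = (-5 : ℤ) * Y ^ 2) (h0 : t ≠ 0) (h1 : t ≠ -1) (h2 : t ≠ 16) :
    ∃ α β ζ δ : ℤ, IsD (-5) α β ζ δ ∧ SameDbl t ((α : ℚ) ^ 2 / (((-5 : ℤ) : ℚ) * β ^ 2)) := by
  have p5 : Prime (5 : ℤ) := by norm_num
  obtain ⟨r, hr⟩ := int_pt (-5) (Or.inr rfl) t Y h
  obtain ⟨n1, n2, n3⟩ := ne_facts t h0 h1 h2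
  have hx : t * t.den = t.num := Rat.mul_den_eq_num t
  have fin : ∀ τ Y : ℚ, τ * (τ + 1) * (τ - 16) = (-5 : ℤ) * Y ^ 2 → τ ≠ 0 → τ ≠ -1 → τ ≠ 16 →
      (5 : ℤ) ∣ τ.den → SameDbl t τ →
      ∃ α β ζ δ : ℤ, IsD (-5) α β ζ δ ∧ SameDbl t ((α : ℚ) ^ 2 / (((-5 : ℤ) : ℚ) * β ^ 2)) := by
    intro τ Y h h0 h1 h2 h5 hs
    obtain ⟨α, β, ζ, δ, hD, e⟩ := Q5 τ Y (by rw [h]; push_cast; ring) h5 h0 h1 h2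
    refine ⟨α, β, ζ, δ, hD, ?_⟩
    rw [show ((-5 : ℤ) : ℚ) = -5 by norm_num, e]; exact hs
  have pole : ∀ (τ : ℚ) (m n : ℤ), n ≠ 0 → (5 : ℤ) ∣ n → ¬ (5 : ℤ) ∣ m → τ = m / n → (5 : ℤ) ∣ τ.den := by
    intro τ m n hn h5 hm e
    have hc := cross τ m n hn e
    have : (5 : ℤ) ∣ m * τ.den := by rw [← hc]; exact h5.mul_left _
    exact (p5.dvd_or_dvd this).resolve_left hm
  have hd : (5 : ℤ) ∣ t.num * t.den * (t.num + t.den) * (t.num - 16 * t.den) := ⟨-1 * r ^ 2, by rw [hr]; ring⟩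
  have hden : (t.den : ℚ) ≠ 0 := by exact_mod_cast t.den_nz
  have nb := not_both t 5 p5
  rcases p5.dvd_or_dvd hd with hd | hd
  · rcases p5.dvd_or_dvd hd with hd | hd
    · rcases p5.dvd_or_dvd hd with hd | hd
      · obtain ⟨⟨Y', hY'⟩, k0, k1, k2, k3⟩ := tr0 _ t Y h h0 h1 h2
        refine fin _ Y' hY' k0 k1 k2 (pole _ (-16 * t.den) t.num n1 hd (fun h => nb hd (by omega)) ?_) k3
        rw [← hx]; push_cast; rw [mul_div_mul_right _ _ hden]
      · exact fin t Y h h0 h1 h2 hd rfl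
    · obtain ⟨⟨Y', hY'⟩, k0, k1, k2, k3⟩ := tr1 _ t Y h h0 h1 h2
      refine fin _ Y' hY' k0 k1 k2 (pole _ (16 * t.den - t.num) (t.num + t.den) n2 hd
        (fun h => nb (by omega) (by omega)) ?_) k3
      push_cast; rw [← hx, ← sub_mul, ← add_one_mul, mul_div_mul_right _ _ hden]
  · obtain ⟨⟨Y', hY'⟩, k0, k1, k2, k3⟩ := tr2 _ t Y h h0 h1 h2
    refine fin _ Y' hY' k0 k1 k2 (pole _ (16 * (t.num + t.den)) (t.num - 16 * t.den) n3 hd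
        (fun h => nb (by omega) (by omega)) ?_) k3
    push_cast; rw [← hx, ← sub_mul, ← add_one_mul, ← mul_assoc, mul_div_mul_right _ _ hden]
end Cub
end

section
namespace Cub

theorem halve (d : ℤ) (hd : d = 1 ∨ d = -5) (α β ζ δ : ℤ) (h : IsD d α β ζ δ) :
    ∃ α' β' ζ' δ' : ℤ, IsD d α' β' ζ' δ' ∧
      (α * (2 * α' * ζ' * δ' * β')) ^ 2 = (β * (α' ^ 4 + 16 * d ^ 2 * β' ^ 4)) ^ 2 := by
  obtain ⟨hc, hb, h1, h2⟩ := h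
  have hd0 : (d : ℚ) ≠ 0 := by rcases hd with rfl | rfl <;> norm_num
  have hb0 : (β : ℚ) ≠ 0 := by exact_mod_cast hb
  obtain ⟨e, he⟩ : ∃ e : ℚ, e = d * (β : ℚ) ^ 2 := ⟨_, rfl⟩
  have he0 : e ≠ 0 := by rw [he]; positivity
  have e1 : (ζ : ℚ) ^ 2 = α ^ 2 + e := by rw [he]; exact_mod_cast h1.symm
  have e2 : (δ : ℚ) ^ 2 = α ^ 2 - 16 * e := by
    rw [he, ← mul_assoc]; exact_mod_cast h2.symm
  have a1 : (α : ℚ) + ζ ≠ 0 := by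
    intro h; apply he0
    linear_combination (ζ - α : ℚ) * h - e1
  have a2 : (α : ℚ) + δ ≠ 0 := by
    intro h; apply he0
    linear_combination (1 / 16 : ℚ) * (α - δ) * h + (1 / 16 : ℚ) * e2
  have a3 : (ζ : ℚ) + δ ≠ 0 := by
    intro h; apply he0
    linear_combination (1 / 17 : ℚ) * (ζ - δ) * h - (1 / 17 : ℚ) * (e1 - e2)
  obtain ⟨q, hq⟩ : ∃ q : ℚ, q * e = (α + ζ) * (α + δ) := ⟨(α + ζ) * (α + δ) / e, by field_simp⟩
  have hq1 : (q + 1) * e = (α + ζ) * (ζ + δ) := by linear_combination hq - e1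
  have hq2 : (q - 16) * e = (α + δ) * (ζ + δ) := by linear_combination hq - e2
  have q0 : q ≠ 0 := by rintro rfl; rw [zero_mul] at hq; exact mul_ne_zero a1 a2 hq.symm
  have q1 : q ≠ -1 := by
    rintro rfl; rw [neg_add_cancel, zero_mul] at hq1; exact mul_ne_zero a1 a3 hq1.symm
  have q2 : q ≠ 16 := by
    rintro rfl; rw [sub_self, zero_mul] at hq2; exact mul_ne_zero a2 a3 hq2.symm
  have hQ0 : q * (q + 1) * (q - 16) ≠ 0 :=
    mul_ne_zero (mul_ne_zero q0 (fun h => q1 (by linarith))) (fun h => q2 (by linarith))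
  have hQ : q * (q + 1) * (q - 16) * e ^ 3 = ((α + ζ) * (α + δ) * (ζ + δ)) ^ 2 := by
    calc q * (q + 1) * (q - 16) * e ^ 3 = (q * e) * ((q + 1) * e) * ((q - 16) * e) := by ring
      _ = _ := by rw [hq, hq1, hq2]; ring
  have hY : q * (q + 1) * (q - 16) = d * (((α : ℚ) + ζ) * (α + δ) * (ζ + δ) / (d ^ 2 * β ^ 3)) ^ 2 := by
    rw [div_pow, ← hQ, he]
    field_simp
  have hN : (q ^ 2 + 16) * e ^ 2 = 2 * α * ((α + ζ) * (α + δ) * (ζ + δ)) := by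
    have : 16 * e ^ 2 = (ζ ^ 2 - α ^ 2) * ((α : ℚ) ^ 2 - δ ^ 2) := by rw [e1, e2]; ring
    calc (q ^ 2 + 16) * e ^ 2 = (q * e) ^ 2 + 16 * e ^ 2 := by ring
      _ = _ := by rw [hq, this]; ring
  have hdbl : (q ^ 2 + 16) ^ 2 * e = 4 * α ^ 2 * (q * (q + 1) * (q - 16)) := by
    apply mul_right_cancel₀ (pow_ne_zero 3 he0)
    calc (q ^ 2 + 16) ^ 2 * e * e ^ 3 = ((q ^ 2 + 16) * e ^ 2) ^ 2 := by ring
      _ = 4 * α ^ 2 * (q * (q + 1) * (q - 16) * e ^ 3) := by rw [hN, hQ]; ring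
      _ = _ := by ring
  obtain ⟨α', β', ζ', δ', hD, hs⟩ : ∃ α' β' ζ' δ' : ℤ, IsD d α' β' ζ' δ' ∧
      SameDbl q ((α' : ℚ) ^ 2 / ((d : ℚ) * β' ^ 2)) := by
    rcases hd with rfl | rfl
    · exact sel1 q _ hY q0 q1 q2
    · exact sel5 q _ hY q0 q1 q2
  refine ⟨α', β', ζ', δ', hD, ?_⟩
  obtain ⟨hc', hb', h1', h2'⟩ := hD
  have hb0' : (β' : ℚ) ≠ 0 := by exact_mod_cast hb'
  obtain ⟨f, hf⟩ : ∃ f : ℚ, f = d * (β' : ℚ) ^ 2 := ⟨_, rfl⟩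
  have hf0 : f ≠ 0 := by rw [hf]; positivity
  have f1 : (ζ' : ℚ) ^ 2 = α' ^ 2 + f := by rw [hf]; exact_mod_cast h1'.symm
  have f2 : (δ' : ℚ) ^ 2 = α' ^ 2 - 16 * f := by
    rw [hf, ← mul_assoc]; exact_mod_cast h2'.symm
  obtain ⟨τ, hτ⟩ : ∃ τ : ℚ, τ = (α' : ℚ) ^ 2 / ((d : ℚ) * β' ^ 2) := ⟨_, rfl⟩
  rw [← hτ] at hs
  rw [← hf] at hτ
  have hτ' : τ * f = α' ^ 2 := by rw [hτ]; field_simp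
  unfold SameDbl at hs
  have hs2 : (τ ^ 2 + 16) ^ 2 * e = 4 * α ^ 2 * (τ * (τ + 1) * (τ - 16)) := by
    apply mul_right_cancel₀ hQ0
    linear_combination e * hs + (τ * (τ + 1) * (τ - 16)) * hdbl
  have hs3 : ((τ * f) ^ 2 + 16 * f ^ 2) ^ 2 * e = 4 * α ^ 2 * ((τ * f) * (τ * f + f) * (τ * f - 16 * f)) * f := by
    linear_combination f ^ 4 * hs2
  rw [hτ', ← f1, ← f2, he, hf] at hs3
  have hs4 : (d : ℚ) * ((α * (2 * α' * ζ' * δ' * β')) ^ 2 - (β * (α' ^ 4 + 16 * d ^ 2 * β' ^ 4)) ^ 2) = 0 := by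
    linear_combination -hs3
  have hs5 := (mul_eq_zero.1 hs4).resolve_left hd0
  have hs6 := sub_eq_zero.1 hs5
  exact_mod_cast hs6

theorem noD (d : ℤ) (hd : d = 1 ∨ d = -5) (n : ℕ) :
    ∀ α β ζ δ : ℤ, IsD d α β ζ δ → (2 : ℤ) ^ n ∣ β := by
  induction n with
  | zero => intro α β ζ δ _; simp
  | succ n ih =>
    intro α β ζ δ h
    obtain ⟨x, y, u, v, hD, hs⟩ := halve d hd α β ζ δ h
    have ihy := ih x y u v hD
    obtain ⟨hc, hy, h1, h2⟩ := hD
    have odd_dvd : ∀ (k : ℕ) (m : ℤ), m % 2 = 1 → (2 : ℤ) ^ k ∣ β * m → (2 : ℤ) ^ k ∣ β := by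
      intro k m hm h
      exact (cop_odd m hm k).symm.dvd_of_dvd_mul_right h
    have hdv : ∀ z : ℤ, z ∣ α * (2 * x * u * v * y) → z ∣ β * (x ^ 4 + 16 * d ^ 2 * y ^ 4) := by
      intro z hz
      rcases sq_eq_sq_iff_eq_or_eq_neg.1 hs with e | e
      · rwa [e] at hz
      · rw [e] at hz; exact (dvd_neg.1 hz)
    have x4 : x % 2 = 1 → (x ^ 4 + 16 * d ^ 2 * y ^ 4) % 2 = 1 := by
      intro hx
      have := odd_sq8 (x ^ 2) (by rw [sq_odd_iff]; exact hx)
      rw [← pow_mul] at this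
      norm_num at this
      have e : 16 * d ^ 2 * y ^ 4 = 2 * (8 * d ^ 2 * y ^ 4) := by ring
      omega
    rcases Int.emod_two_eq_zero_or_one y with hy2 | hy2
    · have hx : x % 2 = 1 := by
        by_contra hx
        have := hc.isUnit_of_dvd' (show (2 : ℤ) ∣ x by omega) (show (2 : ℤ) ∣ y by omega)
        rw [Int.isUnit_iff] at this; omega
      apply odd_dvd _ _ (x4 hx)
      apply hdv
      obtain ⟨k, hk⟩ := ihy
      exact ⟨α * (x * u * v * k), by rw [hk]; ring⟩
    · -- `y` odd
      have hn : n = 0 := by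
        rcases Nat.eq_zero_or_pos n with h | h
        · exact h
        · exfalso
          have : (2 : ℤ) ∣ y := (dvd_pow_self 2 h.ne').trans ihy
          omega
      subst hn
      rw [zero_add]
      have hy8 := odd_sq8 y hy2
      rcases hd with rfl | rfl
      · have hx2 : x % 2 = 0 := by
          rcases Int.emod_two_eq_zero_or_one x with h | h
          · exact h
          · exfalso
            have := odd_sq8 x h
            have := sq_odd_iff u
            rcases Int.emod_two_eq_zero_or_one u with h' | h'
            · obtain ⟨k, rfl⟩ : ∃ k, u = 2 * k := ⟨u / 2, by omega⟩
              have e : (2 * k) ^ 2 = 4 * k ^ 2 := by ring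
              omega
            · omega
        have hu2 : u % 2 = 1 := by
          have := sq_odd_iff u
          have := sq_odd_iff x
          omega
        have hu8 := odd_sq8 u hu2
        obtain ⟨k, rfl⟩ : ∃ k, x = 2 * k := ⟨x / 2, by omega⟩
        have hk2 : k % 2 = 0 := by
          have := sq_odd_iff k
          have e : (2 * k) ^ 2 = 4 * k ^ 2 := by ring
          omega
        obtain ⟨l, rfl⟩ : ∃ l, k = 2 * l := ⟨k / 2, by omega⟩
        obtain ⟨v', hv⟩ : (4 : ℤ) ∣ v := by
          rw [← Int.pow_dvd_pow_iff (n := 2) (by norm_num), ← h2]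
          exact ⟨l ^ 2 - y ^ 2, by ring⟩
        have hv3 : v' ^ 2 = l ^ 2 - y ^ 2 := by rw [hv] at h2; linarith
        have hl : l % 2 = 1 := by
          rcases Int.emod_two_eq_zero_or_one l with h | h
          · exfalso
            obtain ⟨m, rfl⟩ : ∃ m, l = 2 * m := ⟨l / 2, by omega⟩
            have e : (2 * m) ^ 2 = 4 * m ^ 2 := by ring
            have := sq_odd_iff v'
            have := odd_sq8 v' (by omega)
            omega
          · exact h
        have hl8 := odd_sq8 l hl
        have hv2 : v' % 2 = 0 := by
          have := sq_odd_iff v'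
          omega
        obtain ⟨m, rfl⟩ : ∃ m, v' = 2 * m := ⟨v' / 2, by omega⟩
        have hy4 := odd_sq8 (y ^ 2) (by rw [sq_odd_iff]; exact hy2)
        have := hdv (2 ^ 1 * 16) ⟨α * (2 * l * u * m * y), by rw [hv]; ring⟩
        have e : β * ((2 * (2 * l)) ^ 4 + 16 * 1 ^ 2 * y ^ 4) = β * (16 * l ^ 4 + (y ^ 2) ^ 2) * 16 := by ring
        rw [e] at this
        have := Int.dvd_of_mul_dvd_mul_right (by norm_num) this
        refine odd_dvd 1 _ ?_ this
        omega
      · have hx2 : x % 2 = 1 := by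
          rcases Int.emod_two_eq_zero_or_one x with h | h
          · exfalso
            obtain ⟨k, rfl⟩ : ∃ k, x = 2 * k := ⟨x / 2, by omega⟩
            have e : (2 * k) ^ 2 = 4 * k ^ 2 := by ring
            have := sq_odd_iff u
            have := odd_sq8 u (by omega)
            omega
          · exact h
        apply odd_dvd _ _ (x4 hx2)
        apply hdv
        exact ⟨α * (x * u * v * y), by ring⟩

theorem noD' (d : ℤ) (hd : d = 1 ∨ d = -5) (α β ζ δ : ℤ) (h : IsD d α β ζ δ) : False := by
  apply h.2.1
  by_contra hb
  have h1 := noD d hd (β.natAbs) α β ζ δ h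
  have h2 := Int.le_of_dvd (abs_pos.2 hb) ((dvd_abs _ _).2 h1)
  have h3 : β.natAbs < 2 ^ β.natAbs := Nat.lt_two_pow_self
  zify at h3
  omega

theorem tors17 (d : ℤ) (hd : d = 1 ∨ d = -5) (t Y : ℚ) (h : t * (t + 1) * (t - 16) = d * Y ^ 2) :
    t = 0 ∨ t = -1 ∨ t = 16 := by
  by_contra hcon
  push Not at hcon
  obtain ⟨h0, h1, h2⟩ := hcon
  rcases hd with rfl | rfl
  · obtain ⟨α, β, ζ, δ, hD, -⟩ := sel1 t Y h h0 h1 h2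
    exact noD' 1 (Or.inl rfl) α β ζ δ hD
  · obtain ⟨α, β, ζ, δ, hD, -⟩ := sel5 t Y h h0 h1 h2
    exact noD' (-5) (Or.inr rfl) α β ζ δ hD

/-- `X₀(17)` in the model `Y² = v (v² + 30 v + 289)`. -/
theorem f17 (d : ℤ) (hd : d = 1 ∨ d = -5) (v Y : ℚ) (h : d * Y ^ 2 = v * (v ^ 2 + 30 * v + 289)) :
    v = 0 ∨ v = 17 ∧ d = 1 := by
  by_cases hv : v = 0
  · exact Or.inl hv
  right
  obtain ⟨t, ht⟩ : ∃ t, t = (v ^ 2 + 30 * v + 289) / (4 * v) := ⟨_, rfl⟩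
  have ht' : 4 * v * t = v ^ 2 + 30 * v + 289 := by rw [ht]; field_simp
  have h3 : t * (t + 1) * (t - 16) = d * (Y * (v ^ 2 - 289) / (8 * v ^ 2)) ^ 2 := by
    have : (d : ℚ) * (Y * (v ^ 2 - 289) / (8 * v ^ 2)) ^ 2 = (d * Y ^ 2) * (v ^ 2 - 289) ^ 2 / (64 * v ^ 4) := by
      rw [div_pow]; ring
    rw [this, h, ht]
    field_simp
    ring
  rcases tors17 d hd t _ h3 with rfl | rfl | rfl
  · exfalso; nlinarith [sq_nonneg (v + 15)]
  · -- `v = -17`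
    exfalso
    have : (v + 17) ^ 2 = 0 := by linear_combination -ht'
    have hv17 : v = -17 := by have := pow_eq_zero_iff (two_ne_zero) |>.1 this; linarith
    subst hv17
    rcases hd with rfl | rfl
    · push_cast at h; nlinarith [sq_nonneg Y]
    · push_cast at h
      obtain ⟨r, hr⟩ := int_of_sq (-5) (Or.inr rfl) Y (-1156) (by push_cast; linarith)
      rw [hr] at h
      have : (-5 : ℤ) * r ^ 2 = -1156 := by
        have : ((-5 * r ^ 2 : ℤ) : ℚ) = (-1156 : ℤ) := by push_cast; linarith
        exact_mod_cast this
      omega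
  · have : (v - 17) ^ 2 = 0 := by linear_combination -ht'
    have hv17 : v = 17 := by have := pow_eq_zero_iff (two_ne_zero) |>.1 this; linarith
    refine ⟨hv17, ?_⟩
    rcases hd with rfl | rfl
    · rfl
    · exfalso
      subst hv17
      push_cast at h; nlinarith [sq_nonneg Y]
end Cub
end

section
namespace Cub

theorem tw (b2 c b6 x1 x2 w1 w2 : ℚ) (hx2 : x2 ≠ 0)
    (re : w1 ^ 2 - 5 * w2 ^ 2 = 4 * (x1 ^ 3 - 15 * x1 * x2 ^ 2) + b2 * (x1 ^ 2 - 5 * x2 ^ 2) + c * x1 + b6)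
    (im : 2 * w1 * w2 = 4 * (3 * x1 ^ 2 * x2 - 5 * x2 ^ 3) + 2 * b2 * x1 * x2 + c * x2) :
    ∃ m X W : ℚ, X = -(5 * m ^ 2 + b2) / 4 - 2 * x1 ∧ W = w2 - m * (X - x1) ∧
      10 * m * w2 = 4 * (3 * x1 ^ 2 - 5 * x2 ^ 2) + 2 * b2 * x1 + c ∧
      (-5) * W ^ 2 = 4 * X ^ 3 + b2 * X ^ 2 + c * X + b6 := by
  obtain ⟨m, hm⟩ : ∃ m, w1 = 5 * m * x2 := ⟨w1 / (5 * x2), by field_simp⟩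
  subst hm
  have im' : 10 * m * w2 = 4 * (3 * x1 ^ 2 - 5 * x2 ^ 2) + 2 * b2 * x1 + c := by
    apply mul_right_cancel₀ hx2
    linear_combination im
  refine ⟨m, -(5 * m ^ 2 + b2) / 4 - 2 * x1, _, rfl, rfl, im', ?_⟩
  linear_combination re + (-(5 * m ^ 2 + b2) / 4 - 3 * x1) * im'


theorem indep {K : Type*} [Field K] [CharZero K] (Z : K) (hZ : Z ^ 2 = -5)
    (a b : ℚ) (h : (a : K) + b * Z = 0) : a = 0 ∧ b = 0 := by
  have e : ((a ^ 2 : ℚ) : K) = ((-5 * b ^ 2 : ℚ) : K) := by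
    push_cast
    linear_combination (a - b * Z : K) * h + (b : K) ^ 2 * hZ
  have e' : a ^ 2 = -5 * b ^ 2 := by exact_mod_cast e
  have h1 := sq_nonneg a
  have h2 := sq_nonneg b
  have h3 : a ^ 2 = 0 := by linarith
  have h4 : b ^ 2 = 0 := by linarith
  exact ⟨by simpa using h3, by simpa using h4⟩

theorem reim {K : Type*} [Field K] [CharZero K] (Z : K) (hZ : Z ^ 2 = -5)
    (b2 c b6 x1 x2 w1 w2 : ℚ) (h : ((w1 : K) + w2 * Z) ^ 2 =
    4 * (x1 + x2 * Z) ^ 3 + b2 * (x1 + x2 * Z) ^ 2 + c * (x1 + x2 * Z) + b6) :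
    w1 ^ 2 - 5 * w2 ^ 2 = 4 * (x1 ^ 3 - 15 * x1 * x2 ^ 2) + b2 * (x1 ^ 2 - 5 * x2 ^ 2) + c * x1 + b6 ∧
    2 * w1 * w2 = 4 * (3 * x1 ^ 2 * x2 - 5 * x2 ^ 3) + 2 * b2 * x1 * x2 + c * x2 := by
  have := indep Z hZ (w1 ^ 2 - 5 * w2 ^ 2 - (4 * (x1 ^ 3 - 15 * x1 * x2 ^ 2) + b2 * (x1 ^ 2 - 5 * x2 ^ 2) + c * x1 + b6))
    (2 * w1 * w2 - (4 * (3 * x1 ^ 2 * x2 - 5 * x2 ^ 3) + 2 * b2 * x1 * x2 + c * x2)) (by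
      push_cast
      linear_combination h - ((w2 : K) ^ 2 - 4 * (3 * x1 * x2 ^ 2 + x2 ^ 3 * Z) - b2 * x2 ^ 2) * hZ)
  exact ⟨by linarith [this.1], by linarith [this.2]⟩

/-- If the twist has no points, all points are rational. -/
theorem ratpt {K : Type*} [Field K] [CharZero K] (Z : K) (hZ : Z ^ 2 = -5)
    (hrep : ∀ x : K, ∃ a b : ℚ, x = a + b * Z)
    (b2 c b6 : ℚ) (htw : ∀ X W : ℚ, (-5) * W ^ 2 = 4 * X ^ 3 + b2 * X ^ 2 + c * X + b6 → False)
    (x w : K) (h : w ^ 2 = 4 * x ^ 3 + b2 * x ^ 2 + c * x + b6) :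
    ∃ x1 w1 : ℚ, x = x1 ∧ w = w1 ∧ w1 ^ 2 = 4 * x1 ^ 3 + b2 * x1 ^ 2 + c * x1 + b6 := by
  obtain ⟨x1, x2, rfl⟩ := hrep x
  obtain ⟨w1, w2, rfl⟩ := hrep w
  obtain ⟨re, im⟩ := reim Z hZ b2 c b6 x1 x2 w1 w2 h
  by_cases hx2 : x2 = 0
  · subst hx2
    have : w1 * w2 = 0 := by linarith
    rcases mul_eq_zero.1 this with rfl | rfl
    · exact (htw x1 w2 (by linarith)).elim
    · exact ⟨x1, w1, by simp, by simp, by linarith⟩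
  · obtain ⟨m, X, W, -, -, -, e⟩ := tw b2 c b6 x1 x2 w1 w2 hx2 re im
    exact (htw X W e).elim

theorem no17 (s q : ℚ) (h : 25 * s ^ 4 + 300 * s ^ 2 + 20 * q ^ 2 = 256) : False := by
  have hx : s * s.den = s.num := Rat.mul_den_eq_num s
  obtain ⟨r, hr⟩ := int_of_sq 1 (Or.inl rfl) (10 * q * s.den ^ 2)
    (5 * (256 * s.den ^ 4 - 25 * s.num ^ 4 - 300 * s.num ^ 2 * s.den ^ 2)) (by
      push_cast
      rw [← hx]
      linear_combination (5 * (s.den : ℚ) ^ 4) * h)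
  have e : r ^ 2 = 5 * (256 * s.den ^ 4 - 25 * s.num ^ 4 - 300 * s.num ^ 2 * s.den ^ 2) := by
    have : ((r ^ 2 : ℤ) : ℚ) = ((5 * (256 * s.den ^ 4 - 25 * s.num ^ 4 - 300 * s.num ^ 2 * s.den ^ 2) : ℤ) : ℚ) := by
      push_cast
      rw [← hr, ← hx]
      linear_combination (5 * (s.den : ℚ) ^ 4) * h
    exact_mod_cast this
  have p5 : Prime (5 : ℤ) := by norm_num
  have nb := not_both s 5 p5
  revert e nb
  generalize s.num = n
  generalize (s.den : ℤ) = k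
  intro e nb
  obtain ⟨r', rfl⟩ : (5 : ℤ) ∣ r := p5.dvd_of_dvd_pow (n := 2) ⟨_, e⟩
  have e2 : 256 * k ^ 4 = 5 * (r' ^ 2 + 5 * n ^ 4 + 60 * n ^ 2 * k ^ 2) := by linarith
  obtain ⟨k', rfl⟩ : (5 : ℤ) ∣ k := by
    apply p5.dvd_of_dvd_pow (n := 4)
    exact (p5.dvd_or_dvd (⟨_, e2⟩ : (5 : ℤ) ∣ 256 * k ^ 4)).resolve_left (by norm_num)
  obtain ⟨r'', rfl⟩ : (5 : ℤ) ∣ r' := p5.dvd_of_dvd_pow (n := 2)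
    ⟨256 * 25 * k' ^ 4 - n ^ 4 - 300 * n ^ 2 * k' ^ 2, by linarith⟩
  refine nb (p5.dvd_of_dvd_pow (n := 4) ⟨256 * 5 * k' ^ 4 - 60 * n ^ 2 * k' ^ 2 - r'' ^ 2, by linarith⟩)
    (dvd_mul_right _ _)

theorem ratpt17 {K : Type*} [Field K] [CharZero K] (Z : K) (hZ : Z ^ 2 = -5)
    (hrep : ∀ x : K, ∃ a b : ℚ, x = a + b * Z)
    (v Y : K) (h : Y ^ 2 = v * (v ^ 2 + 30 * v + 289)) :
    ∃ v1 Y1 : ℚ, v = v1 ∧ Y = Y1 ∧ Y1 ^ 2 = v1 * (v1 ^ 2 + 30 * v1 + 289) := by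
  obtain ⟨x1, x2, rfl⟩ := hrep v
  obtain ⟨y1, y2, rfl⟩ := hrep Y
  obtain ⟨re, im⟩ := reim Z hZ 120 1156 0 x1 x2 (2 * y1) (2 * y2) (by
    push_cast; linear_combination 4 * h)
  by_cases hx2 : x2 = 0
  · subst hx2
    have : y1 * y2 = 0 := by linarith
    rcases mul_eq_zero.1 this with rfl | rfl
    · rcases f17 (-5) (Or.inr rfl) x1 y2 (by push_cast; linarith) with rfl | ⟨-, h⟩
      · have : y2 = 0 := by
          have : y2 ^ 2 = 0 := by linarith
          simpa using this
        subst this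
        exact ⟨0, 0, by simp, by simp, by simp⟩
      · norm_num at h
    · exact ⟨x1, y1, by simp, by simp, by linarith⟩
  · exfalso
    obtain ⟨m, X, W, hX, hW, hm, e⟩ := tw 120 1156 0 x1 x2 (2 * y1) (2 * y2) hx2 re im
    rcases f17 (-5) (Or.inr rfl) X (W / 2) (by push_cast; linarith) with rfl | ⟨-, h⟩
    · have hW0 : W = 0 := by
        have : W ^ 2 = 0 := by linarith
        simpa using this
      have hx1 : x1 = -15 - 5 * m ^ 2 / 8 := by linarith
      have hw : 2 * y2 = - m * x1 := by linarith
      apply no17 (m / 2) x2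
      rw [hw, hx1] at hm
      linear_combination hm
    · norm_num at h

theorem card_pts {K : Type*} [Field K] [CharZero K] (W : WeierstrassCurve.Affine K) (S : Finset (ℚ × ℚ))
    (h : ∀ x y : K, W.Nonsingular x y ↔ ∃ p ∈ S, x = ((p.1 : ℚ) : K) ∧ y = ((p.2 : ℚ) : K)) :
    Nat.card W.Point = S.card + 1 := by
  let f : Option S → W.Point := fun o => match o with
    | none => .zero
    | some p => .some (p.1.1 : K) (p.1.2 : K) ((h _ _).2 ⟨p.1, p.2, rfl, rfl⟩)
  have hf : Function.Bijective f := by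
    constructor
    · rintro (_ | ⟨⟨a, b⟩, hp⟩) (_ | ⟨⟨c, d⟩, hq⟩) e
      · rfl
      · simp [f] at e
      · simp [f] at e
      · simp [f] at e
        simp [e.1, e.2]
    · rintro (_ | ⟨x, y, hxy⟩)
      · exact ⟨none, rfl⟩
      · obtain ⟨p, hp, rfl, rfl⟩ := (h x y).1 hxy
        exact ⟨some ⟨p, hp⟩, rfl⟩
  rw [← Nat.card_congr (Equiv.ofBijective f hf)]
  simp

end Cub
end

namespace Cub

theorem rep_adjoin (z : ℂ) (hz : z ^ 2 = -5) (x : ℚ⟮z⟯) :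
    ∃ a b : ℚ, x = (a : ℚ⟮z⟯) + b * (AdjoinSimple.gen ℚ z) := by
  have hint : IsIntegral ℚ z := by
    refine ⟨Polynomial.X ^ 2 + Polynomial.C 5, ?_, ?_⟩
    · exact Polynomial.monic_X_pow_add_C _ two_ne_zero
    · simp [hz]
  have hmem : (x : ℂ) ∈ Algebra.adjoin ℚ {z} := by
    rw [← adjoin_simple_toSubalgebra_of_isAlgebraic hint.isAlgebraic]
    exact x.2
  have main : ∃ a b : ℚ, (x : ℂ) = a + b * z := by
    generalize (x : ℂ) = x' at hmem
    induction hmem using Algebra.adjoin_induction with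
    | mem y hy =>
      rw [Set.mem_singleton_iff] at hy
      exact ⟨0, 1, by simp [hy]⟩
    | algebraMap r => exact ⟨r, 0, by simp⟩
    | add u v _ _ hu hv =>
      obtain ⟨a, b, rfl⟩ := hu
      obtain ⟨c, d, rfl⟩ := hv
      exact ⟨a + c, b + d, by push_cast; ring⟩
    | mul u v _ _ hu hv =>
      obtain ⟨a, b, rfl⟩ := hu
      obtain ⟨c, d, rfl⟩ := hv
      refine ⟨a * c - 5 * b * d, a * d + b * c, ?_⟩
      push_cast
      linear_combination (b * d : ℂ) * hz
  obtain ⟨a, b, h⟩ := main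
  refine ⟨a, b, ?_⟩
  apply Subtype.ext
  rw [h]
  simp

theorem quad_roots {K : Type*} [Field K] {a b y : K} (h : (y - a) * (y - b) = 0) : y = a ∨ y = b := by
  rcases mul_eq_zero.1 h with h | h
  · exact Or.inl (sub_eq_zero.1 h)
  · exact Or.inr (sub_eq_zero.1 h)

theorem rational_of {K : Type*} [Field K] [CharZero K] (W : WeierstrassCurve.Affine K) (S : Finset (ℚ × ℚ))
    (h : ∀ x y : K, W.Nonsingular x y ↔ ∃ p ∈ S, x = ((p.1 : ℚ) : K) ∧ y = ((p.2 : ℚ) : K)) :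
    PointsRational W := by
  intro x y hxy
  obtain ⟨p, -, hx, hy⟩ := (h x y).1 hxy
  exact ⟨⟨p.1, hx.symm⟩, ⟨p.2, hy.symm⟩⟩

theorem pts11 {K : Type*} [Field K] [CharZero K] (Z : K) (hZ : Z ^ 2 = -5)
    (hrep : ∀ x : K, ∃ a b : ℚ, x = a + b * Z) (x y : K) :
    (X0_11 K).Nonsingular x y ↔
      ∃ p ∈ ({(5, 5), (5, -6), (16, 60), (16, -61)} : Finset (ℚ × ℚ)), x = ((p.1 : ℚ) : K) ∧ y = ((p.2 : ℚ) : K) := by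
  rw [WeierstrassCurve.Affine.nonsingular_iff', WeierstrassCurve.Affine.equation_iff]
  simp only [X0_11]
  constructor
  · rintro ⟨h, -⟩
    obtain ⟨x1, w1, hx, hw, e⟩ := ratpt Z hZ hrep (-4) (-40) (-79)
      (fun X W h => f11_m5 X W (by linarith)) x (2 * y + 1) (by push_cast; linear_combination 4 * h)
    rcases f11_one x1 w1 (by linarith) with rfl | rfl
    · subst hx
      rcases quad_roots (a := (5 : K)) (b := -6) (y := y) (by push_cast at h; linear_combination h) with rfl | rfl
      · exact ⟨(5, 5), by simp, by simp⟩
      · exact ⟨(5, -6), by simp, by simp⟩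
    · subst hx
      rcases quad_roots (a := (60 : K)) (b := -61) (y := y) (by push_cast at h; linear_combination h) with rfl | rfl
      · exact ⟨(16, 60), by simp, by simp⟩
      · exact ⟨(16, -61), by simp, by simp⟩
  · rintro ⟨p, hp, rfl, rfl⟩
    simp only [Finset.mem_insert, Finset.mem_singleton] at hp
    rcases hp with rfl | rfl | rfl | rfl <;> norm_num

theorem pts19 {K : Type*} [Field K] [CharZero K] (Z : K) (hZ : Z ^ 2 = -5)
    (hrep : ∀ x : K, ∃ a b : ℚ, x = a + b * Z) (x y : K) :
    (X0_19 K).Nonsingular x y ↔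
      ∃ p ∈ ({(5, 9), (5, -10)} : Finset (ℚ × ℚ)), x = ((p.1 : ℚ) : K) ∧ y = ((p.2 : ℚ) : K) := by
  rw [WeierstrassCurve.Affine.nonsingular_iff', WeierstrassCurve.Affine.equation_iff]
  simp only [X0_19]
  constructor
  · rintro ⟨h, -⟩
    obtain ⟨x1, w1, hx, hw, e⟩ := ratpt Z hZ hrep 4 (-36) (-59)
      (fun X W h => f19_m5 X W (by linarith)) x (2 * y + 1) (by push_cast; linear_combination 4 * h)
    obtain rfl := f19_one x1 w1 (by linarith)
    subst hx
    rcases quad_roots (a := (9 : K)) (b := -10) (y := y) (by push_cast at h; linear_combination h) with rfl | rfl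
    · exact ⟨(5, 9), by simp, by simp⟩
    · exact ⟨(5, -10), by simp, by simp⟩
  · rintro ⟨p, hp, rfl, rfl⟩
    simp only [Finset.mem_insert, Finset.mem_singleton] at hp
    rcases hp with rfl | rfl <;> norm_num

theorem pts17 {K : Type*} [Field K] [CharZero K] (Z : K) (hZ : Z ^ 2 = -5)
    (hrep : ∀ x : K, ∃ a b : ℚ, x = a + b * Z) (x y : K) :
    (X0_17 K).Nonsingular x y ↔
      ∃ p ∈ ({(11 / 4, -15 / 8), (7, 13), (7, -21)} : Finset (ℚ × ℚ)), x = ((p.1 : ℚ) : K) ∧ y = ((p.2 : ℚ) : K) := by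
  rw [WeierstrassCurve.Affine.nonsingular_iff', WeierstrassCurve.Affine.equation_iff]
  simp only [X0_17]
  constructor
  · rintro ⟨h, -⟩
    obtain ⟨v1, w1, hv, hw, e⟩ := ratpt17 Z hZ hrep (4 * x - 11) (4 * (2 * y + x + 1))
      (by linear_combination 64 * h)
    rcases f17 1 (Or.inl rfl) v1 w1 (by push_cast; linarith) with rfl | ⟨rfl, -⟩
    · have hx : x = 11 / 4 := by push_cast at hv; linear_combination (1 / 4 : K) * hv
      subst hx
      rcases quad_roots (a := (-15 / 8 : K)) (b := -15 / 8) (y := y) (by linear_combination h) with rfl | rfl <;>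
      exact ⟨(11 / 4, -15 / 8), by simp, by simp⟩
    · have hx : x = 7 := by push_cast at hv; linear_combination (1 / 4 : K) * hv
      subst hx
      rcases quad_roots (a := (13 : K)) (b := -21) (y := y) (by linear_combination h) with rfl | rfl
      · exact ⟨(7, 13), by simp, by simp⟩
      · exact ⟨(7, -21), by simp, by simp⟩
  · rintro ⟨p, hp, rfl, rfl⟩
    simp only [Finset.mem_insert, Finset.mem_singleton] at hp
    rcases hp with rfl | rfl | rfl <;> norm_num

end Cub

/-- Let `K = ℚ(√-5)`. Then `X₀(11)(K)` has exactly 5 elements, `X₀(17)(K)` has exactly 4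
elements, and `X₀(19)(K)` has exactly 3 elements; in each case `X₀(p)(K)` coincides with
the group `X₀(p)(ℚ)` of rational points. -/
theorem X0_points_sqrt_neg5 (z : ℂ) (hz : z ^ 2 = -5) :
    (Nat.card (X0_11 ℚ⟮z⟯).Point = 5 ∧ PointsRational (X0_11 ℚ⟮z⟯)) ∧
    (Nat.card (X0_17 ℚ⟮z⟯).Point = 4 ∧ PointsRational (X0_17 ℚ⟮z⟯)) ∧
    (Nat.card (X0_19 ℚ⟮z⟯).Point = 3 ∧ PointsRational (X0_19 ℚ⟮z⟯)) := by
  have hZ : (AdjoinSimple.gen ℚ z) ^ 2 = -5 := by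
    apply Subtype.ext
    rw [SubmonoidClass.coe_pow, AdjoinSimple.coe_gen, hz]
    rfl
  have hrep := Cub.rep_adjoin z hz
  have h11 := Cub.pts11 _ hZ hrep
  have h17 := Cub.pts17 _ hZ hrep
  have h19 := Cub.pts19 _ hZ hrep
  refine ⟨⟨?_, Cub.rational_of _ _ h11⟩, ⟨?_, Cub.rational_of _ _ h17⟩, ⟨?_, Cub.rational_of _ _ h19⟩⟩
  · rw [Cub.card_pts _ _ h11]; rfl
  · rw [Cub.card_pts _ _ h17]
    rw [Finset.card_insert_of_notMem (by norm_num), Finset.card_insert_of_notMem (by norm_num),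
      Finset.card_singleton]
  · rw [Cub.card_pts _ _ h19]; rfl
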